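/- arXiv:2604.10274 — 2 statements merged into one kernel-verified Lean document; each statement's English description precedes it below -/
import Mathlib

section
/- For each ι ∈ {0,1}, there exists a refinement π ∈ Π_ι that is level-optimal maximin. -/
/- STATEMENT 8: Level-optimal maximin refinements exist.  The side `ι ∈ {0,1}` is formalized
abstractly: `X` plays the role of `Ω_ι` and `Y` of `Ω_ῑ`; instantiating `(X, Y) = (Ω0, Ω1)`
gives the case `ι = 0` and `(X, Y) = (Ω1, Ω0)` (with the transposed relation) the case `ι = 1`. -/

open MeasureTheory ProbabilityTheory Filter
open scoped ENNReal NNReal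

noncomputable section

/-- The nonnegative part of an extended real number, as an element of `ℝ≥0∞`. -/
def erealToENNReal (a : EReal) : ℝ≥0∞ :=
  if a = ⊤ then ⊤ else ENNReal.ofReal a.toReal

/-- Extended-real integral via positive/negative parts. -/
def erealIntegral {Ω : Type} [MeasurableSpace Ω] (μ : Measure Ω) (f : Ω → EReal) : EReal :=
  ((∫⁻ x, erealToENNReal (f x) ∂μ : ℝ≥0∞) : EReal)
    - ((∫⁻ x, erealToENNReal (-f x) ∂μ : ℝ≥0∞) : EReal)

/-- Recession slope of `θ`, i.e. `lim_{t → ∞} θ t / t`. -/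
def recessionSlope (θ : ℝ → EReal) : EReal :=
  Filter.limsup (fun t : ℝ => θ t * ((t⁻¹ : ℝ) : EReal)) Filter.atTop

/-- The `θ`-divergence `D_θ(P‖Q) = ∫ θ(dP_ac/dQ) dQ + θ'_∞ · P⊥(Ω)`. -/
def thetaDiv {Ω : Type} [MeasurableSpace Ω] (θ : ℝ → EReal) (P Q : Measure Ω) : EReal :=
  erealIntegral Q (fun x => θ ((P.rnDeriv Q x).toReal))
    + recessionSlope θ * ((P.singularPart Q Set.univ : ℝ≥0∞) : EReal)

/-- `θ : [0,∞) → ℝ ∪ {+∞}` is proper, convex and lower semicontinuous. -/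
structure ProperConvexLSCOn (θ : ℝ → EReal) : Prop where
  ne_bot : ∀ x : ℝ, 0 ≤ x → θ x ≠ ⊥
  exists_ne_top : ∃ x : ℝ, 0 ≤ x ∧ θ x ≠ ⊤
  convex : ∀ x y a b : ℝ, 0 ≤ x → 0 ≤ y → 0 ≤ a → 0 ≤ b → a + b = 1 →
    θ (a * x + b * y) ≤ (a : EReal) * θ x + (b : EReal) * θ y
  lsc : LowerSemicontinuousOn θ (Set.Ici 0)

/-- `θ` is strictly convex on its effective domain (within `[0,∞)`). -/
def StrictlyConvexOnDom (θ : ℝ → EReal) : Prop :=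
  ∀ x y a b : ℝ, 0 ≤ x → 0 ≤ y → x ≠ y → θ x ≠ ⊤ → θ y ≠ ⊤ → 0 < a → 0 < b → a + b = 1 →
    θ (a * x + b * y) < (a : EReal) * θ x + (b : EReal) * θ y

variable {X Y : Type} [MeasurableSpace X] [MeasurableSpace Y]

/-- Refinements of `νX` on side `X`: finite plans concentrated on `E` with `X`-marginal `νX`. -/
def Plans (E : Set (X × Y)) (νX : Measure X) : Set (Measure (X × Y)) :=
  {π | IsFiniteMeasure π ∧ π Eᶜ = 0 ∧ π.map Prod.fst = νX}

/-- Refinements of `νY` on side `Y`. -/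
def PlansSnd (E : Set (X × Y)) (νY : Measure Y) : Set (Measure (X × Y)) :=
  {π | IsFiniteMeasure π ∧ π Eᶜ = 0 ∧ π.map Prod.snd = νY}

/-- Capped feasible subplans at level `t`. -/
def Feas (E : Set (X × Y)) (νX : Measure X) (νY : Measure Y) (t : ℝ) :
    Set (Measure (X × Y)) :=
  {σ | IsFiniteMeasure σ ∧ σ Eᶜ = 0 ∧ σ.map Prod.fst ≤ νX ∧
    σ.map Prod.snd ≤ (ENNReal.ofReal t) • νY}

/-- Maximal feasible mass at level `t`. -/
def Fit (E : Set (X × Y)) (νX : Measure X) (νY : Measure Y) (t : ℝ) : ℝ≥0∞ :=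
  ⨆ σ ∈ Feas E νX νY t, σ Set.univ

/-- Level-optimal maximin: at every level `t > 0` the truncated opposite marginal mass
realizes the maximal feasible mass. -/
def LevelOptMaximin (E : Set (X × Y)) (νX : Measure X) (νY : Measure Y)
    (π : Measure (X × Y)) : Prop :=
  ∀ t : ℝ, 0 < t →
    ∫⁻ y, min ((π.map Prod.snd).rnDeriv νY y) (ENNReal.ofReal t) ∂νY = Fit E νX νY t

/-- A finite measure carried by the range of a continuous map from a compact space lifts to a finite
measure on that space. -/
lemma exists_map_eq_of_compactSpace {K Z : Type*} [TopologicalSpace K] [CompactSpace K] [T2Space K]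
    [SecondCountableTopology K] [MeasurableSpace K] [BorelSpace K] [Nonempty K]
    [TopologicalSpace Z] [PolishSpace Z] [MeasurableSpace Z] [BorelSpace Z]
    {p : K → Z} (hp : Continuous p) (ρ : Measure Z) [IsFiniteMeasure ρ]
    (hρ : ρ (Set.range p)ᶜ = 0) :
    ∃ κ : Measure K, IsFiniteMeasure κ ∧ κ.map p = ρ := by
  let _ := TopologicalSpace.upgradeIsCompletelyMetrizable Z
  let z : ℕ → K := TopologicalSpace.denseSeq K
  let h : ℕ → Z → K := fun N x => z (SimpleFunc.nearestPtInd (p ∘ z) N x)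
  have hmeas : ∀ N, Measurable (h N) := fun N =>
    (measurable_from_top (f := z)).comp (SimpleFunc.measurable _)
  have hlim : ∀ᵐ x ∂ρ, Tendsto (fun N => p (h N x)) atTop (nhds x) := by
    filter_upwards [compl_mem_ae_iff.2 hρ] with x hx
    rw [compl_compl] at hx
    refine SimpleFunc.tendsto_nearestPt (e := p ∘ z) ?_
    rw [Set.range_comp]
    obtain ⟨k, rfl⟩ := hx
    exact (image_closure_subset_closure_image hp)
      ⟨k, by rw [(TopologicalSpace.denseRange_denseSeq K).closure_range]; trivial, rfl⟩
  let ρ' : FiniteMeasure Z := ⟨ρ, inferInstance⟩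
  let κs : ℕ → FiniteMeasure K := fun N => ρ'.map (h N)
  have hmass : ∀ N, (κs N).mass ≤ ρ'.mass := fun N => by
    rw [← ENNReal.coe_le_coe, FiniteMeasure.ennreal_mass, FiniteMeasure.ennreal_mass]
    simp only [κs, FiniteMeasure.toMeasure_map]
    rw [Measure.map_apply (hmeas N) MeasurableSet.univ, Set.preimage_univ]
  obtain ⟨κ, -, hκ⟩ := (isCompact_setOfPred_finiteMeasure_le_of_compactSpace K ρ'.mass)
    |>.ultrafilter_le_nhds ((hyperfilter ℕ).map κs) (by
      rw [Ultrafilter.coe_map, le_principal_iff]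
      exact Filter.mem_map.2 (Eventually.of_forall hmass))
  have hκ' : Tendsto κs (hyperfilter ℕ : Filter ℕ) (nhds κ) := hκ
  have hle : (hyperfilter ℕ : Filter ℕ) ≤ atTop := Nat.hyperfilter_le_atTop
  have h1 := FiniteMeasure.tendsto_map_of_tendsto_of_continuous κs κ hκ' hp
  have h2 : Tendsto (fun i => (κs i).map p) (hyperfilter ℕ : Filter ℕ) (nhds ρ') := by
    refine Tendsto.mono_left ?_ hle
    rw [FiniteMeasure.tendsto_iff_forall_integral_tendsto]
    intro f
    have : ∀ i, ∫ x, f x ∂((κs i).map p : Measure Z) = ∫ x, f (p (h i x)) ∂ρ := by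
      intro i
      simp only [κs, FiniteMeasure.toMeasure_map]
      rw [integral_map hp.aemeasurable f.continuous.aestronglyMeasurable,
        integral_map (φ := h i) (f := fun y => f (p y)) (hmeas i).aemeasurable
          (f.continuous.comp hp).aestronglyMeasurable]
      rfl
    simp only [this]
    refine tendsto_integral_of_dominated_convergence (fun _ => ‖f‖) (fun i => ?_)
      (integrable_const _) (fun i => Eventually.of_forall fun x => f.norm_coe_le_norm _) ?_
    · exact (f.continuous.measurable.comp (hp.measurable.comp (hmeas i))).aestronglyMeasurable
    · filter_upwards [hlim] with x hx
      exact (f.continuous.tendsto _).comp hx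
  have h3 := tendsto_nhds_unique h1 h2
  refine ⟨κ, inferInstance, ?_⟩
  rw [← FiniteMeasure.toMeasure_map, h3]
  rfl

/-- The compact box below `k` in Baire space. -/
def baireBox (k : ℕ → ℕ) : Set (ℕ → ℕ) := Set.univ.pi fun i => Set.Iic (k i)

lemma isCompact_baireBox (k : ℕ → ℕ) : IsCompact (baireBox k) :=
  isCompact_univ_pi fun i => (Set.finite_Iic (k i)).isCompact

/-- The image of Baire space is approximated from inside, in outer measure, by images of boxes. -/
lemma exists_lt_measure_image_baireBox {Z : Type*} [TopologicalSpace Z]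
    [MeasurableSpace Z] {p : (ℕ → ℕ) → Z} (hp : Continuous p) (ρ : Measure Z)
    [ρ.OuterRegular] {δ : ℝ≥0∞} (hδ : δ < ρ (Set.range p)) :
    ∃ k, δ ≤ ρ (p '' baireBox k) := by
  have step : ∀ (A : {A : Set (ℕ → ℕ) // δ < ρ (p '' A)}) (n : ℕ),
      ∃ j : ℕ, δ < ρ (p '' (A.1 ∩ {x | x n ≤ j})) := by
    rintro ⟨A, hA⟩ n
    have hU : p '' A = ⋃ j : ℕ, p '' (A ∩ {x | x n ≤ j}) := by
      rw [← Set.image_iUnion, ← Set.inter_iUnion]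
      congr 1
      refine (Set.inter_eq_left.2 fun x _ => ?_).symm
      exact Set.mem_iUnion.2 ⟨x n, le_refl (x n)⟩
    have hm : Monotone fun j : ℕ => p '' (A ∩ {x | x n ≤ j}) := fun i j hij =>
      Set.image_mono (Set.inter_subset_inter_right _ fun x hx => le_trans hx hij)
    rw [hU, hm.measure_iUnion] at hA
    exact lt_iSup_iff.1 hA
  choose j hj using step
  let A : ℕ → {A : Set (ℕ → ℕ) // δ < ρ (p '' A)} := fun n =>
    Nat.rec ⟨Set.univ, by rwa [Set.image_univ]⟩ (fun n B => ⟨B.1 ∩ {x | x n ≤ j B n}, hj B n⟩) n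
  let k : ℕ → ℕ := fun n => j (A n) n
  have hA : ∀ n, (A n).1 ⊆ {x | ∀ i < n, x i ≤ k i} := by
    intro n
    induction n with
    | zero => intro x _ i hi; omega
    | succ n ih =>
      rintro x ⟨hx, hxn⟩ i hi
      rcases Nat.lt_succ_iff_lt_or_eq.1 hi with hi | rfl
      · exact ih hx i hi
      · exact hxn
  refine ⟨k, ?_⟩
  rw [Set.measure_eq_iInf_isOpen]
  refine le_iInf fun U => le_iInf fun hU => le_iInf fun hUo => ?_
  suffices h : ∃ n, (A n).1 ⊆ p ⁻¹' U by
    obtain ⟨n, hn⟩ := h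
    exact (A n).2.le.trans (measure_mono (Set.image_subset_iff.2 hn))
  by_contra! hcon
  have hcon' : ∀ n, ∃ x, x ∈ (A n).1 ∧ p x ∉ U := fun n => Set.not_subset.1 (hcon n)
  choose x hxA hxU using hcon'
  obtain ⟨y, hy, φ, hφ, hlim⟩ := (isCompact_baireBox k).tendsto_subseq
    (x := fun n i => min (x n i) (k i)) (fun n i _ => min_le_right (x n i) (k i))
  have hlim' : Tendsto (x ∘ φ) atTop (nhds y) := by
    rw [tendsto_pi_nhds] at hlim ⊢
    intro i
    refine (hlim i).congr' ?_
    filter_upwards [eventually_gt_atTop i] with n hn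
    exact min_eq_left (hA _ (hxA (φ n)) i (hn.trans_le (hφ.id_le n)))
  have hmem : y ∈ (p ⁻¹' U)ᶜ := (hUo.preimage hp).isClosed_compl.mem_of_tendsto hlim'
    (Eventually.of_forall fun n => hxU (φ n))
  exact hmem (hU ⟨y, hy, rfl⟩)

/-- A finite measure lifts along a continuous surjection from Baire space. -/
lemma exists_map_eq_of_baire_surjective {Z : Type*} [TopologicalSpace Z] [PolishSpace Z]
    [MeasurableSpace Z] [BorelSpace Z] {p : (ℕ → ℕ) → Z} (hp : Continuous p)
    (hs : Function.Surjective p) (ρ : Measure Z) [IsFiniteMeasure ρ] :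
    ∃ κ : Measure (ℕ → ℕ), κ.map p = ρ := by
  rcases eq_or_ne ρ 0 with rfl | hρ
  · exact ⟨0, by simp⟩
  have hpos : 0 < ρ Set.univ := by simpa [pos_iff_ne_zero] using hρ
  obtain ⟨δ, -, hδ, hδlim⟩ := exists_seq_strictMono_tendsto' hpos
  have hk : ∀ n, ∃ k, δ n ≤ ρ (p '' baireBox k) := fun n =>
    exists_lt_measure_image_baireBox hp ρ (by rw [hs.range_eq]; exact (hδ n).2)
  choose k hk using hk
  let B : ℕ → Set Z := fun n => p '' baireBox (k n)
  have hB : ∀ n, MeasurableSet (B n) := fun n =>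
    ((isCompact_baireBox (k n)).image hp).measurableSet
  have hfull : ρ (⋃ n, B n)ᶜ = 0 := by
    rw [measure_compl (MeasurableSet.iUnion hB) (measure_ne_top _ _), tsub_eq_zero_iff_le]
    exact le_of_tendsto' hδlim fun n => (hk n).trans (measure_mono (Set.subset_iUnion B n))
  have hpiece : ∀ n, ∃ κ : Measure (ℕ → ℕ), κ.map p = ρ.restrict (disjointed B n) := by
    intro n
    have : CompactSpace (baireBox (k n)) := isCompact_iff_compactSpace.1 (isCompact_baireBox _)
    have : Nonempty (baireBox (k n)) := ⟨⟨fun _ => 0, fun i _ => Nat.zero_le _⟩⟩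
    obtain ⟨κ, -, hκ⟩ := exists_map_eq_of_compactSpace (K := baireBox (k n))
      (p := fun x => p x.1) (hp.comp continuous_subtype_val) (ρ.restrict (disjointed B n)) (by
        have hr : Set.range (fun x : baireBox (k n) => p x.1) = B n := by
          rw [Set.range_comp' p Subtype.val, Subtype.range_coe]
        rw [hr, Measure.restrict_apply (hB n).compl]
        refine measure_mono_null (fun x hx => ?_) measure_empty
        exact (hx.1 (disjointed_subset B n hx.2)).elim)
    refine ⟨κ.map Subtype.val, ?_⟩
    rw [Measure.map_map hp.measurable measurable_subtype_coe]
    exact hκ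
  choose κ hκ using hpiece
  refine ⟨Measure.sum κ, ?_⟩
  rw [Measure.map_sum hp.aemeasurable]
  simp only [hκ]
  rw [← Measure.restrict_iUnion (disjoint_disjointed B)
    (fun i => MeasurableSet.disjointed hB i), iUnion_disjointed]
  exact Measure.restrict_eq_self_of_ae_mem (mem_ae_iff.2 hfull)

/-- Every finite measure on `X` is the first marginal of a finite measure on a closed relation with
nonempty sections. -/
lemma exists_plan [TopologicalSpace X] [PolishSpace X] [BorelSpace X]
    [TopologicalSpace Y] [PolishSpace Y] [BorelSpace Y]
    {E : Set (X × Y)} (hE : IsClosed E) (hN : ∀ x : X, ∃ y : Y, (x, y) ∈ E)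
    (ρ : Measure X) [IsFiniteMeasure ρ] :
    ∃ κ : Measure (X × Y), κ Eᶜ = 0 ∧ κ.map Prod.fst = ρ := by
  rcases isEmpty_or_nonempty X with hX | ⟨⟨x₀⟩⟩
  · exact ⟨0, by simp, by rw [Measure.map_zero]; exact (Measure.eq_zero_of_isEmpty ρ).symm⟩
  obtain ⟨y₀, h₀⟩ := hN x₀
  have : Nonempty E := ⟨⟨_, h₀⟩⟩
  have : PolishSpace E := hE.polishSpace
  obtain ⟨f, hf, hfs⟩ := PolishSpace.exists_nat_nat_continuous_surjective E
  have hg : Continuous fun z => (f z : X × Y) := continuous_subtype_val.comp hf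
  obtain ⟨κ, hκ⟩ := exists_map_eq_of_baire_surjective (p := fun z => (f z : X × Y).1)
    (continuous_fst.comp hg)
    (fun x => by
      obtain ⟨y, hy⟩ := hN x
      obtain ⟨z, hz⟩ := hfs ⟨_, hy⟩
      exact ⟨z, by simp [hz]⟩) ρ
  refine ⟨κ.map fun z => (f z : X × Y), ?_, ?_⟩
  · rw [Measure.map_apply hg.measurable hE.measurableSet.compl]
    refine measure_mono_null (fun z hz => ?_) measure_empty
    exact (hz (f z).2).elim
  · rw [Measure.map_map measurable_fst hg.measurable]
    exact hκ

/-- An upper bound on the masses of an open set passes to weak limits of finite measures. -/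
lemma measure_le_of_tendsto_of_isOpen {Z ι : Type*} [TopologicalSpace Z] [MeasurableSpace Z]
    [OpensMeasurableSpace Z] [HasOuterApproxClosed Z] {L : Filter ι} [L.NeBot]
    {μs : ι → FiniteMeasure Z} {μ : FiniteMeasure Z} (hμ : Tendsto μs L (nhds μ))
    {G : Set Z} (hG : IsOpen G) {b : ι → ℝ≥0∞} {β : ℝ≥0∞} (hβ : β ≠ ∞)
    (hb : Tendsto b L (nhds β)) (hle : ∀ i, (μs i : Measure Z) G ≤ b i) :
    (μ : Measure Z) G ≤ β := by
  have hmass : Tendsto (fun i => (μs i : Measure Z) Set.univ) L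
      (nhds ((μ : Measure Z) Set.univ)) := by
    simp only [← FiniteMeasure.ennreal_mass]
    exact ENNReal.tendsto_coe.2 hμ.mass
  have h1 : Tendsto (fun i => (μs i : Measure Z) Set.univ - b i) L
      (nhds ((μ : Measure Z) Set.univ - β)) := ENNReal.Tendsto.sub hmass hb (Or.inr hβ)
  have h2 : (μ : Measure Z) Set.univ - β ≤ (μ : Measure Z) Gᶜ := by
    rw [← h1.limsup_eq]
    refine le_trans (limsup_le_limsup (Eventually.of_forall fun i => ?_))
      (FiniteMeasure.limsup_measure_closed_le_of_tendsto hμ hG.isClosed_compl)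
    change (μs i : Measure Z) Set.univ - b i ≤ (μs i : Measure Z) Gᶜ
    rw [measure_compl hG.measurableSet (measure_ne_top _ _)]
    exact tsub_le_tsub_left (hle i) _
  rw [measure_compl hG.measurableSet (measure_ne_top _ _)] at h2
  have h3 := tsub_le_iff_right.1 h2
  have h4 : (μ : Measure Z) G ≤ (μ : Measure Z) Set.univ := measure_mono (Set.subset_univ G)
  have hne : (μ : Measure Z) Set.univ - (μ : Measure Z) G ≠ ∞ :=
    ENNReal.sub_ne_top (measure_ne_top _ _)
  rw [← ENNReal.add_le_add_iff_left hne, tsub_add_cancel_of_le h4]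
  exact h3

lemma measure_le_of_forall_isOpen {Z : Type*} [TopologicalSpace Z] [MeasurableSpace Z]
    {μ ν : Measure Z} [ν.OuterRegular] (h : ∀ G, IsOpen G → μ G ≤ ν G) : μ ≤ ν := by
  refine Measure.le_iff.2 fun s _ => ?_
  rw [s.measure_eq_iInf_isOpen ν]
  exact le_iInf fun U => le_iInf fun hU => le_iInf fun hUo => (measure_mono hU).trans (h U hUo)

/-- A family of plans with dominated marginals has a weak limit along the hyperfilter. -/
lemma exists_tendsto_of_marginals_le [TopologicalSpace X] [PolishSpace X] [BorelSpace X]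
    [TopologicalSpace Y] [PolishSpace Y] [BorelSpace Y]
    (μ : Measure X) (ρ : Measure Y) [IsFiniteMeasure μ] [IsFiniteMeasure ρ]
    (σ : ℕ → FiniteMeasure (X × Y)) (hX : ∀ n, (σ n : Measure (X × Y)).map Prod.fst ≤ μ)
    (hY : ∀ n, (σ n : Measure (X × Y)).map Prod.snd ≤ ρ) :
    ∃ σ' : FiniteMeasure (X × Y), Tendsto σ (hyperfilter ℕ : Filter ℕ) (nhds σ') := by
  obtain ⟨u, -, hu0, hu⟩ := exists_seq_strictAnti_tendsto (0 : ℝ≥0)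
  have hcX : ∀ n, ∃ K : Set X, IsCompact K ∧ μ Kᶜ ≤ u n := fun n => by
    obtain ⟨K, -, hK, hlt⟩ := MeasurableSet.univ.exists_isCompact_lt_add (measure_ne_top μ _)
      (ENNReal.coe_ne_zero.2 (hu0 n).ne')
    refine ⟨K, hK, ?_⟩
    rw [measure_compl hK.measurableSet (measure_ne_top _ _)]
    exact tsub_le_iff_left.2 hlt.le
  have hcY : ∀ n, ∃ K : Set Y, IsCompact K ∧ ρ Kᶜ ≤ u n := fun n => by
    obtain ⟨K, -, hK, hlt⟩ := MeasurableSet.univ.exists_isCompact_lt_add (measure_ne_top ρ _)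
      (ENNReal.coe_ne_zero.2 (hu0 n).ne')
    refine ⟨K, hK, ?_⟩
    rw [measure_compl hK.measurableSet (measure_ne_top _ _)]
    exact tsub_le_iff_left.2 hlt.le
  choose K hK hKle using hcX
  choose J hJ hJle using hcY
  have hcomp := isCompact_setOfPred_finiteMeasure_mass_le_compl_isCompact_le
    (u := fun n => u n + u n) (K := fun n => K n ×ˢ J n) (μ Set.univ).toNNReal
    (by simpa using hu.add hu) (fun n => (hK n).prod (hJ n)) (by
      left
      let _ := TopologicalSpace.upgradeIsCompletelyMetrizable (X × Y)
      infer_instance)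
  have hmem : ∀ n, (σ n).mass ≤ (μ Set.univ).toNNReal ∧
      ∀ m, (σ n) (K m ×ˢ J m)ᶜ ≤ u m + u m := by
    intro n
    constructor
    · rw [← ENNReal.coe_le_coe, FiniteMeasure.ennreal_mass,
        ENNReal.coe_toNNReal (measure_ne_top _ _)]
      have := hX n Set.univ
      rwa [Measure.map_apply measurable_fst MeasurableSet.univ, Set.preimage_univ] at this
    · intro m
      rw [← ENNReal.coe_le_coe, FiniteMeasure.ennreal_coeFn_eq_coeFn_toMeasure, ENNReal.coe_add,
        Set.compl_prod_eq_union]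
      refine (measure_union_le _ _).trans (add_le_add ?_ ?_)
      · have := hX n (K m)ᶜ
        rw [Measure.map_apply measurable_fst (hK m).measurableSet.compl] at this
        rw [Set.prod_univ]
        exact this.trans (hKle m)
      · have := hY n (J m)ᶜ
        rw [Measure.map_apply measurable_snd (hJ m).measurableSet.compl] at this
        rw [Set.univ_prod]
        exact this.trans (hJle m)
  obtain ⟨σ', -, hσ'⟩ := hcomp.ultrafilter_le_nhds ((hyperfilter ℕ).map σ) (by
    rw [Ultrafilter.coe_map, le_principal_iff]
    exact Filter.mem_map.2 (Eventually.of_forall hmem))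
  exact ⟨σ', hσ'⟩

lemma map_withDensity_comp {Z W : Type*} [MeasurableSpace Z] [MeasurableSpace W] (μ : Measure Z)
    {g : Z → W} (hg : Measurable g) {f : W → ℝ≥0∞} (hf : Measurable f) :
    (μ.withDensity (f ∘ g)).map g = (μ.map g).withDensity f := by
  ext s hs
  rw [Measure.map_apply hg hs, withDensity_apply _ (hg hs), withDensity_apply _ hs,
    setLIntegral_map hs hf hg]
  rfl

/-- A measure below the image of `π` is the image of a measure below `π`. -/
lemma exists_le_map_eq {Z W : Type*} [MeasurableSpace Z] [MeasurableSpace W] (π : Measure Z)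
    [IsFiniteMeasure π] {g : Z → W} (hg : Measurable g) {q : Measure W} (hq : q ≤ π.map g) :
    ∃ σ ≤ π, σ.map g = q := by
  have : IsFiniteMeasure q := isFiniteMeasure_of_le _ hq
  refine ⟨π.withDensity (q.rnDeriv (π.map g) ∘ g), ?_, ?_⟩
  · have h1 : ∀ᵐ z ∂π, q.rnDeriv (π.map g) (g z) ≤ 1 :=
      ae_of_ae_map hg.aemeasurable (Measure.rnDeriv_le_one_of_le hq)
    calc π.withDensity (q.rnDeriv (π.map g) ∘ g) ≤ π.withDensity 1 := withDensity_mono h1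
      _ = π := withDensity_one
  · rw [map_withDensity_comp π hg (Measure.measurable_rnDeriv _ _),
      Measure.withDensity_rnDeriv_eq _ _ (Measure.absolutelyContinuous_of_le hq)]

/-- `σ` is carried by `E` and its first marginal is at most `ν`. -/
structure IsSubplan (E : Set (X × Y)) (ν : Measure X) (σ : Measure (X × Y)) : Prop where
  null : σ Eᶜ = 0
  fst_le : σ.map Prod.fst ≤ ν

namespace IsSubplan

variable {E : Set (X × Y)} {ν : Measure X} {σ τ : Measure (X × Y)}

lemma mono (h : IsSubplan E ν σ) (hle : τ ≤ σ) : IsSubplan E ν τ :=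
  ⟨nonpos_iff_eq_zero.1 ((hle _).trans h.null.le),
    (Measure.map_mono hle measurable_fst).trans h.fst_le⟩

lemma measure_univ_le (h : IsSubplan E ν σ) : σ Set.univ ≤ ν Set.univ := by
  have := h.fst_le Set.univ
  rwa [Measure.map_apply measurable_fst MeasurableSet.univ, Set.preimage_univ] at this

lemma isFiniteMeasure (h : IsSubplan E ν σ) [IsFiniteMeasure ν] : IsFiniteMeasure σ :=
  ⟨h.measure_univ_le.trans_lt (measure_lt_top _ _)⟩

lemma convex (hσ : IsSubplan E ν σ) (hτ : IsSubplan E ν τ) {a b : ℝ≥0} (hab : a + b = 1) :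
    IsSubplan E ν (a • σ + b • τ) where
  null := by simp [hσ.null, hτ.null]
  fst_le := by
    rw [Measure.map_add _ _ measurable_fst, Measure.map_smul, Measure.map_smul]
    calc a • σ.map Prod.fst + b • τ.map Prod.fst ≤ a • ν + b • ν := by
          gcongr
          · exact hσ.fst_le
          · exact hτ.fst_le
      _ = ν := by rw [← add_smul, hab, one_smul]

end IsSubplan

/-- Second marginal densities of subplans are closed under almost everywhere limits. -/
lemma exists_subplan_of_tendsto [TopologicalSpace X] [PolishSpace X] [BorelSpace X]
    [TopologicalSpace Y] [PolishSpace Y] [BorelSpace Y]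
    {E : Set (X × Y)} (hE : IsClosed E) {νX : Measure X} {νY : Measure Y} [IsFiniteMeasure νX]
    {σ : ℕ → Measure (X × Y)} (hσ : ∀ n, IsSubplan E νX (σ n))
    {R : ℕ → Y → ℝ≥0∞} (hR : ∀ n, Measurable (R n)) {r : Y → ℝ≥0∞} (hr : Measurable r)
    (hfin : ∫⁻ y, r y ∂νY ≠ ∞) (hle : ∀ n, νY.withDensity (R n) ≤ (σ n).map Prod.snd)
    (hlim : ∀ᵐ y ∂νY, Tendsto (fun n => R n y) atTop (nhds (r y))) :
    ∃ τ, IsSubplan E νX τ ∧ τ.map Prod.snd = νY.withDensity r := by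
  have hmr : ∀ n, Measurable fun y => min (R n y) (r y) := fun n => (hR n).min hr
  have hex : ∀ n, ∃ τ ≤ σ n, τ.map Prod.snd = νY.withDensity fun y => min (R n y) (r y) := by
    intro n
    have := (hσ n).isFiniteMeasure
    refine exists_le_map_eq (σ n) measurable_snd (le_trans ?_ (hle n))
    exact withDensity_mono (Eventually.of_forall fun y => min_le_left _ _)
  choose τ hτσ hτ using hex
  have hτsub : ∀ n, IsSubplan E νX (τ n) := fun n => (hσ n).mono (hτσ n)
  have hτfin : ∀ n, IsFiniteMeasure (τ n) := fun n => (hτsub n).isFiniteMeasure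
  have hρ : IsFiniteMeasure (νY.withDensity r) := isFiniteMeasure_withDensity hfin
  let τ' : ℕ → FiniteMeasure (X × Y) := fun n => ⟨τ n, hτfin n⟩
  obtain ⟨κ, hκ⟩ := exists_tendsto_of_marginals_le νX (νY.withDensity r) τ'
    (fun n => (hτsub n).fst_le) (fun n => by
      change (τ n).map Prod.snd ≤ _
      rw [hτ n]
      exact withDensity_mono (Eventually.of_forall fun y => min_le_right _ _))
  let _ := TopologicalSpace.upgradeIsCompletelyMetrizable X
  let _ := TopologicalSpace.upgradeIsCompletelyMetrizable Y
  have hint : ∀ s : Set Y, MeasurableSet s → Tendsto (fun n => (τ n).map Prod.snd s)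
      (hyperfilter ℕ : Filter ℕ) (nhds (νY.withDensity r s)) := by
    intro s hs
    refine Tendsto.mono_left ?_ Nat.hyperfilter_le_atTop
    simp only [hτ, withDensity_apply _ hs]
    refine tendsto_lintegral_of_dominated_convergence r hmr
      (fun n => Eventually.of_forall fun y => min_le_right _ _)
      (ne_top_of_le_ne_top hfin (setLIntegral_le_lintegral _ _)) ?_
    filter_upwards [ae_restrict_of_ae hlim] with y hy
    simpa using hy.min (tendsto_const_nhds (x := r y))
  refine ⟨κ, ⟨?_, ?_⟩, ?_⟩
  · refine nonpos_iff_eq_zero.1 ?_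
    exact measure_le_of_tendsto_of_isOpen hκ hE.isOpen_compl ENNReal.zero_ne_top
      tendsto_const_nhds fun n => (hτsub n).null.le
  · refine measure_le_of_forall_isOpen fun G hG => ?_
    rw [Measure.map_apply measurable_fst hG.measurableSet]
    refine measure_le_of_tendsto_of_isOpen hκ (hG.preimage continuous_fst) (measure_ne_top _ _)
      tendsto_const_nhds fun n => ?_
    have := (hτsub n).fst_le G
    rwa [Measure.map_apply measurable_fst hG.measurableSet] at this
  · refine Measure.eq_of_le_of_measure_univ_eq (measure_le_of_forall_isOpen fun G hG => ?_) ?_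
    · rw [Measure.map_apply measurable_snd hG.measurableSet]
      refine measure_le_of_tendsto_of_isOpen hκ (hG.preimage continuous_snd) (measure_ne_top _ _)
        (hint G hG.measurableSet) fun n => ?_
      rw [Measure.map_apply measurable_snd hG.measurableSet]
      rfl
    · have h1 := hint Set.univ MeasurableSet.univ
      have h2 : Tendsto (fun n => (τ' n : Measure (X × Y)) Set.univ) (hyperfilter ℕ : Filter ℕ)
          (nhds ((κ : Measure (X × Y)) Set.univ)) := by
        simp only [← FiniteMeasure.ennreal_mass]
        exact ENNReal.tendsto_coe.2 hκ.mass
      simp only [Measure.map_apply measurable_snd MeasurableSet.univ, Set.preimage_univ] at h1 ⊢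
      exact tendsto_nhds_unique h2 h1

lemma sq_inv_one_add_sub_le {a b : ℝ} (ha : 0 ≤ a) (hb : 0 ≤ b) :
    ((1 + a)⁻¹ - (1 + b)⁻¹) ^ 2 ≤
      4 * (((1 + a)⁻¹ + (1 + b)⁻¹) / 2 - (1 + (a + b) / 2)⁻¹) := by
  have hA : 0 < 1 + a := by linarith
  have hB : 0 < 1 + b := by linarith
  have hC : 0 < 2 + a + b := by linarith
  have key : 4 * (((1 + a)⁻¹ + (1 + b)⁻¹) / 2 - (1 + (a + b) / 2)⁻¹)
      = ((1 + a)⁻¹ - (1 + b)⁻¹) ^ 2 * (2 * (1 + a) * (1 + b) / (2 + a + b)) := by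
    have : 1 + (a + b) / 2 = (2 + a + b) / 2 := by ring
    rw [this]
    field_simp
    ring
  rw [key]
  refine le_mul_of_one_le_right (sq_nonneg _) ?_
  rw [one_le_div hC]
  nlinarith [mul_nonneg ha hb]

lemma inv_one_add_mem_Icc {a : ℝ} (ha : 0 ≤ a) : (1 + a)⁻¹ ∈ Set.Icc (0 : ℝ) 1 :=
  ⟨by positivity, inv_le_one_of_one_le₀ (by linarith)⟩

/-- The integral of `1 / (1 + r)` for the density `r` of `P` with respect to `ν`. -/
def harmonicCost (ν P : Measure Y) : ℝ := ∫ y, (1 + (P.rnDeriv ν y).toReal)⁻¹ ∂ν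

lemma measurable_inv_one_add_toReal {f : Y → ℝ≥0∞} (hf : Measurable f) :
    Measurable fun y => (1 + (f y).toReal)⁻¹ :=
  (measurable_const.add hf.ennreal_toReal).inv

lemma integrable_inv_one_add_toReal {ν : Measure Y} [IsFiniteMeasure ν] {f : Y → ℝ≥0∞}
    (hf : Measurable f) : Integrable (fun y => (1 + (f y).toReal)⁻¹) ν := by
  refine Integrable.of_bound (measurable_inv_one_add_toReal hf).aestronglyMeasurable 1
    (Eventually.of_forall fun y => ?_)
  have := inv_one_add_mem_Icc (ENNReal.toReal_nonneg (a := f y))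
  rw [Real.norm_of_nonneg this.1]
  exact this.2

lemma harmonicCost_nonneg (ν P : Measure Y) : 0 ≤ harmonicCost ν P :=
  integral_nonneg fun _ => (inv_one_add_mem_Icc ENNReal.toReal_nonneg).1

lemma integral_sq_sub_le_harmonicCost (ν P Q : Measure Y) [IsFiniteMeasure ν] [IsFiniteMeasure P]
    [IsFiniteMeasure Q] :
    ∫ y, ((1 + (P.rnDeriv ν y).toReal)⁻¹ - (1 + (Q.rnDeriv ν y).toReal)⁻¹) ^ 2 ∂ν ≤
      4 * ((harmonicCost ν P + harmonicCost ν Q) / 2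
        - harmonicCost ν ((1 / 2 : ℝ≥0) • P + (1 / 2 : ℝ≥0) • Q)) := by
  have hP := integrable_inv_one_add_toReal (ν := ν) (Measure.measurable_rnDeriv P ν)
  have hQ := integrable_inv_one_add_toReal (ν := ν) (Measure.measurable_rnDeriv Q ν)
  have hM := integrable_inv_one_add_toReal (ν := ν)
    (Measure.measurable_rnDeriv ((1 / 2 : ℝ≥0) • P + (1 / 2 : ℝ≥0) • Q) ν)
  have hPQ : Integrable (fun y =>
      ((1 + (P.rnDeriv ν y).toReal)⁻¹ + (1 + (Q.rnDeriv ν y).toReal)⁻¹) / 2) ν :=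
    (hP.add hQ).div_const 2
  unfold harmonicCost
  rw [← integral_add hP hQ, ← integral_div, ← integral_sub hPQ hM, ← integral_const_mul]
  refine integral_mono_of_nonneg (Eventually.of_forall fun y => sq_nonneg _)
    ((hPQ.sub hM).const_mul 4) ?_
  filter_upwards [Measure.rnDeriv_add' ((1 / 2 : ℝ≥0) • P) ((1 / 2 : ℝ≥0) • Q) ν,
    Measure.rnDeriv_smul_left' P ν (1 / 2), Measure.rnDeriv_smul_left' Q ν (1 / 2),
    Measure.rnDeriv_lt_top P ν, Measure.rnDeriv_lt_top Q ν] with y h1 h2 h3 h4 h5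
  have hmid : (((1 / 2 : ℝ≥0) • P + (1 / 2 : ℝ≥0) • Q).rnDeriv ν y).toReal
      = ((P.rnDeriv ν y).toReal + (Q.rnDeriv ν y).toReal) / 2 := by
    rw [h1, Pi.add_apply, h2, h3]
    simp only [Pi.smul_apply, ENNReal.smul_def, smul_eq_mul]
    rw [ENNReal.toReal_add (ENNReal.mul_ne_top ENNReal.coe_ne_top h4.ne)
      (ENNReal.mul_ne_top ENNReal.coe_ne_top h5.ne), ENNReal.toReal_mul, ENNReal.toReal_mul]
    simp only [ENNReal.coe_toReal]
    push_cast
    ring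
  simp only [hmid]
  exact sq_inv_one_add_sub_le ENNReal.toReal_nonneg ENNReal.toReal_nonneg

/-- Densities whose transforms `1 / (1 + r)` converge do converge in `[0, ∞]`. -/
lemma exists_tendsto_of_tendsto_inv_one_add {R : ℕ → ℝ≥0∞} (hR : ∀ n, R n ≠ ∞) {l : ℝ}
    (h : Tendsto (fun n => (1 + (R n).toReal)⁻¹) atTop (nhds l)) :
    ∃ r, Tendsto R atTop (nhds r) := by
  have h1 : Tendsto (fun n => (1 + R n)⁻¹) atTop (nhds (ENNReal.ofReal l)) := by
    refine (ENNReal.tendsto_ofReal h).congr fun n => ?_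
    rw [ENNReal.ofReal_inv_of_pos (by positivity), ENNReal.ofReal_add zero_le_one
      ENNReal.toReal_nonneg, ENNReal.ofReal_toReal (hR n), ENNReal.ofReal_one]
  have h2 := tendsto_inv_iff.2 h1
  simp only [inv_inv] at h2
  have h3 := ENNReal.Tendsto.sub h2 (tendsto_const_nhds (x := (1 : ℝ≥0∞)))
    (Or.inr ENNReal.one_ne_top)
  refine ⟨_, h3.congr fun n => ?_⟩
  exact ENNReal.add_sub_cancel_left ENNReal.one_ne_top

/-- The harmonic cost of the second marginal attains its minimum over subplans, at a subplan with
absolutely continuous second marginal. -/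
lemma exists_forall_harmonicCost_le [TopologicalSpace X] [PolishSpace X] [BorelSpace X]
    [TopologicalSpace Y] [PolishSpace Y] [BorelSpace Y]
    {E : Set (X × Y)} (hE : IsClosed E) (νX : Measure X) (νY : Measure Y)
    [IsFiniteMeasure νX] [IsFiniteMeasure νY] :
    ∃ σ, IsSubplan E νX σ ∧ σ.map Prod.snd ≪ νY ∧ ∀ τ, IsSubplan E νX τ →
      harmonicCost νY (σ.map Prod.snd) ≤ harmonicCost νY (τ.map Prod.snd) := by
  let S : Set ℝ := (fun σ : Measure (X × Y) => harmonicCost νY (σ.map Prod.snd)) ''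
    {σ | IsSubplan E νX σ}
  have hSne : S.Nonempty := ⟨_, 0, ⟨by simp, by simp [Measure.zero_le]⟩, rfl⟩
  have hSbdd : BddBelow S := ⟨0, by
    rintro _ ⟨σ, -, rfl⟩
    exact harmonicCost_nonneg _ _⟩
  have hmin : ∀ τ, IsSubplan E νX τ → sInf S ≤ harmonicCost νY (τ.map Prod.snd) := fun τ hτ =>
    csInf_le hSbdd ⟨τ, hτ, rfl⟩
  have hex : ∀ n : ℕ, ∃ σ, IsSubplan E νX σ ∧
      harmonicCost νY (σ.map Prod.snd) < sInf S + (1 / 4) ^ n / 8 := fun n => by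
    obtain ⟨_, ⟨σ, hσ, rfl⟩, hlt⟩ := exists_lt_of_csInf_lt hSne
      (lt_add_of_pos_right (sInf S) (by positivity : (0 : ℝ) < (1 / 4) ^ n / 8))
    exact ⟨σ, hσ, hlt⟩
  choose σ hσ hcost using hex
  have hfin : ∀ n, IsFiniteMeasure (σ n) := fun n => (hσ n).isFiniteMeasure
  let R : ℕ → Y → ℝ≥0∞ := fun n => ((σ n).map Prod.snd).rnDeriv νY
  have hR : ∀ n, Measurable (R n) := fun n => Measure.measurable_rnDeriv _ _
  let u : ℕ → Y → ℝ := fun n y => (1 + (R n y).toReal)⁻¹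
  have hu : ∀ n, Measurable (u n) := fun n => measurable_inv_one_add_toReal (hR n)
  have hu1 : ∀ n y, u n y ∈ Set.Icc (0 : ℝ) 1 := fun n y =>
    inv_one_add_mem_Icc ENNReal.toReal_nonneg
  have hsq : ∀ N n m, N ≤ n → N ≤ m → ∫ y, (u n y - u m y) ^ 2 ∂νY ≤ (1 / 4) ^ N / 2 := by
    intro N n m hn hm
    have h1 := integral_sq_sub_le_harmonicCost νY ((σ n).map Prod.snd) ((σ m).map Prod.snd)
    have h2 := hmin _ ((hσ n).convex (hσ m) (a := 1 / 2) (b := 1 / 2) (by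
      rw [← NNReal.coe_inj]; push_cast; norm_num))
    rw [Measure.map_add _ _ measurable_snd, Measure.map_smul, Measure.map_smul] at h2
    have h3 : ∀ k, N ≤ k → ((1 : ℝ) / 4) ^ k ≤ (1 / 4) ^ N := fun k hk =>
      pow_le_pow_of_le_one (by norm_num) (by norm_num) hk
    have := hcost n
    have := hcost m
    have := h3 n hn
    have := h3 m hm
    change ∫ y, (u n y - u m y) ^ 2 ∂νY ≤ _ at h1
    linarith
  have hcauchy : ∀ᵐ y ∂νY, ∃ l, Tendsto (fun n => u n y) atTop (nhds l) := by
    refine Lp.ae_tendsto_of_cauchy_eLpNorm (p := 2) (fun n => (hu n).aestronglyMeasurable)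
      (by norm_num) (B := fun n => ENNReal.ofReal ((1 / 2) ^ n)) ?_ ?_
    · rw [← ENNReal.ofReal_tsum_of_nonneg (fun n => by positivity)
        (summable_geometric_of_lt_one (by norm_num) (by norm_num))]
      exact ENNReal.ofReal_ne_top
    · intro N n m hn hm
      have hL : MemLp (u n - u m) 2 νY := by
        refine MemLp.of_bound ((hu n).sub (hu m)).aestronglyMeasurable 1
          (Eventually.of_forall fun y => ?_)
        rw [Pi.sub_apply, Real.norm_eq_abs, abs_le]
        have := hu1 n y
        have := hu1 m y
        simp only [Set.mem_Icc] at *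
        constructor <;> linarith
      rw [hL.eLpNorm_eq_integral_rpow_norm (by norm_num) (by norm_num)]
      refine (ENNReal.ofReal_lt_ofReal_iff (by positivity)).2 ?_
      have h2 : ∫ y, ‖(u n - u m) y‖ ^ (2 : ℝ≥0∞).toReal ∂νY = ∫ y, (u n y - u m y) ^ 2 ∂νY := by
        refine integral_congr_ae (Eventually.of_forall fun y => ?_)
        simp [Real.norm_eq_abs]
      rw [h2, ENNReal.toReal_ofNat, ← one_div, ← Real.sqrt_eq_rpow, Real.sqrt_lt' (by positivity),
        ← pow_mul, mul_comm, pow_mul]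
      refine (hsq N n m hn hm).trans_lt ?_
      have : (0 : ℝ) < (1 / 4) ^ N := by positivity
      rw [show ((1 : ℝ) / 2) ^ 2 = 1 / 4 by norm_num]
      linarith
  have hRfin : ∀ᵐ y ∂νY, ∀ n, R n y ≠ ∞ := ae_all_iff.2 fun n =>
    (Measure.rnDeriv_lt_top _ _).mono fun y hy => hy.ne
  let r : Y → ℝ≥0∞ := fun y => liminf (fun n => R n y) atTop
  have hr : Measurable r := Measurable.liminf hR
  have hlim : ∀ᵐ y ∂νY, Tendsto (fun n => R n y) atTop (nhds (r y)) := by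
    filter_upwards [hcauchy, hRfin] with y ⟨l, hl⟩ hy
    obtain ⟨s, hs⟩ := exists_tendsto_of_tendsto_inv_one_add hy hl
    rwa [show r y = s from hs.liminf_eq]
  have hrint : ∫⁻ y, r y ∂νY ≠ ∞ := by
    refine ne_top_of_le_ne_top (measure_ne_top νX Set.univ) ((lintegral_liminf_le hR).trans ?_)
    refine liminf_le_of_le (by isBoundedDefault) fun b hb => ?_
    obtain ⟨n, hn⟩ := hb.exists
    refine hn.trans ((Measure.lintegral_rnDeriv_le).trans ?_)
    rw [Measure.map_apply measurable_snd MeasurableSet.univ, Set.preimage_univ]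
    exact (hσ n).measure_univ_le
  obtain ⟨τ, hτ, hτr⟩ := exists_subplan_of_tendsto hE hσ hR hr hrint
    (fun n => Measure.withDensity_rnDeriv_le _ _) hlim
  refine ⟨τ, hτ, by rw [hτr]; exact withDensity_absolutelyContinuous _ _, fun ω hω => ?_⟩
  refine le_trans ?_ (hmin ω hω)
  have hτcost : harmonicCost νY (τ.map Prod.snd) = ∫ y, (1 + (r y).toReal)⁻¹ ∂νY := by
    rw [hτr]
    refine integral_congr_ae ?_
    filter_upwards [Measure.rnDeriv_withDensity νY hr] with y hy
    rw [hy]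
  have htend : Tendsto (fun n => harmonicCost νY ((σ n).map Prod.snd)) atTop
      (nhds (harmonicCost νY (τ.map Prod.snd))) := by
    rw [hτcost]
    refine tendsto_integral_of_dominated_convergence (fun _ => 1)
      (fun n => (hu n).aestronglyMeasurable) (integrable_const _)
      (fun n => Eventually.of_forall fun y => ?_) ?_
    · rw [Real.norm_of_nonneg (hu1 n y).1]
      exact (hu1 n y).2
    · filter_upwards [hlim, ae_lt_top hr hrint] with y hy hry
      exact ((ENNReal.tendsto_toReal hry.ne).comp hy |>.const_add 1).inv₀
        (by have := ENNReal.toReal_nonneg (a := r y); positivity)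
  have hup : Tendsto (fun n : ℕ => sInf S + (1 / 4 : ℝ) ^ n / 8) atTop (nhds (sInf S)) := by
    simpa using ((tendsto_pow_atTop_nhds_zero_of_lt_one (by norm_num)
      (by norm_num : (1 / 4 : ℝ) < 1)).div_const 8).const_add (sInf S)
  exact le_of_tendsto_of_tendsto' htend hup fun n => (hcost n).le

/-- First-order optimality for the harmonic cost: a perturbation moving mass from densities at least
`t` to densities below `t` that does not improve the cost is trivial. -/
lemma ae_eq_zero_of_integral_inv_one_add_le {ν : Measure Y} [IsFiniteMeasure ν] {a s d : Y → ℝ}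
    {t : ℝ} (ha : Measurable a) (hs : Integrable s ν) (hd : Integrable d ν)
    (hs0 : ∀ᵐ y ∂ν, 0 ≤ s y) (hd0 : ∀ᵐ y ∂ν, 0 ≤ d y) (hda : ∀ᵐ y ∂ν, d y ≤ a y)
    (hst : ∀ᵐ y ∂ν, t ≤ a y → s y = 0) (hdt : ∀ᵐ y ∂ν, a y < t → d y = 0)
    (ht : 0 ≤ t) (hle : ∫ y, d y ∂ν ≤ ∫ y, s y ∂ν)
    (hmin : ∀ ε : ℝ, 0 < ε → ε < 1 →
      ∫ y, (1 + a y)⁻¹ ∂ν ≤ ∫ y, (1 + (a y + ε * (s y - d y)))⁻¹ ∂ν) :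
    ∀ᵐ y ∂ν, s y = 0 := by
  let F : ℝ → Y → ℝ := fun ε y =>
    (s y - d y) * ((1 + a y)⁻¹ * (1 + (a y + ε * (s y - d y)))⁻¹)
  have hbase : ∀ᵐ y ∂ν, 0 ≤ s y ∧ 0 ≤ d y ∧ d y ≤ a y := hs0.and (hd0.and hda)
  have hpos : ∀ ε : ℝ, 0 < ε → ε < 1 → ∀ᵐ y ∂ν, 0 ≤ a y + ε * (s y - d y) := by
    intro ε h0 h1
    filter_upwards [hbase] with y ⟨h2, h3, h4⟩
    nlinarith [mul_nonneg h0.le h2, mul_nonneg (sub_nonneg.2 h1.le) h3]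
  have hmeas : ∀ ε : ℝ, AEMeasurable (fun y => (1 + (a y + ε * (s y - d y)))⁻¹) ν := fun ε =>
    ((ha.aemeasurable.add ((hs.aemeasurable.sub hd.aemeasurable).const_mul ε)).const_add 1).inv
  have hmeas0 : Measurable fun y => (1 + a y)⁻¹ := (ha.const_add 1).inv
  have hI0 : Integrable (fun y => (1 + a y)⁻¹) ν := by
    refine Integrable.of_bound hmeas0.aestronglyMeasurable 1 ?_
    filter_upwards [hbase] with y ⟨_, h3, h4⟩
    have := inv_one_add_mem_Icc (h3.trans h4)
    rw [Real.norm_of_nonneg this.1]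
    exact this.2
  have hI : ∀ ε : ℝ, 0 < ε → ε < 1 →
      Integrable (fun y => (1 + (a y + ε * (s y - d y)))⁻¹) ν := by
    intro ε h0 h1
    refine Integrable.of_bound (hmeas ε).aestronglyMeasurable 1 ?_
    filter_upwards [hpos ε h0 h1] with y h2
    have := inv_one_add_mem_Icc h2
    rw [Real.norm_of_nonneg this.1]
    exact this.2
  have hF : ∀ ε : ℝ, 0 < ε → ε < 1 → ∫ y, F ε y ∂ν ≤ 0 := by
    intro ε h0 h1
    have h2 : ∫ y, ε * F ε y ∂ν
        = ∫ y, ((1 + a y)⁻¹ - (1 + (a y + ε * (s y - d y)))⁻¹) ∂ν := by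
      refine integral_congr_ae ?_
      filter_upwards [hbase, hpos ε h0 h1] with y ⟨_, h3, h4⟩ h5
      have h6 : 1 + a y ≠ 0 := by linarith
      have h7 : 1 + (a y + ε * (s y - d y)) ≠ 0 := by linarith
      simp only [F]
      rw [inv_sub_inv h6 h7, ← mul_inv, div_eq_mul_inv]
      ring
    rw [integral_const_mul, integral_sub hI0 (hI ε h0 h1)] at h2
    have h3 := hmin ε h0 h1
    by_contra! h4
    have := mul_pos h0 h4
    linarith
  let e : ℕ → ℝ := fun n => 1 / ((n : ℝ) + 1) / 2
  have he0 : ∀ n, 0 < e n := fun n => by positivity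
  have he1 : ∀ n, e n < 1 := fun n => by
    have : 1 / ((n : ℝ) + 1) ≤ 1 := by
      rw [div_le_one (by positivity)]
      linarith [Nat.cast_nonneg (α := ℝ) n]
    change 1 / ((n : ℝ) + 1) / 2 < 1
    linarith
  have he : Tendsto e atTop (nhds 0) := by
    have := (tendsto_one_div_add_atTop_nhds_zero_nat (𝕜 := ℝ)).div_const 2
    rwa [zero_div] at this
  have hbound : ∀ n, ∀ᵐ y ∂ν, ‖F (e n) y‖ ≤ s y + d y := by
    intro n
    filter_upwards [hbase, hpos (e n) (he0 n) (he1 n)] with y ⟨h2, h3, h4⟩ h5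
    have h6 := inv_one_add_mem_Icc (h3.trans h4)
    have h7 := inv_one_add_mem_Icc h5
    rw [norm_mul, Real.norm_of_nonneg (mul_nonneg h6.1 h7.1), Real.norm_eq_abs]
    calc |s y - d y| * ((1 + a y)⁻¹ * (1 + (a y + e n * (s y - d y)))⁻¹)
        ≤ |s y - d y| * 1 :=
          mul_le_mul_of_nonneg_left (mul_le_one₀ h6.2 h7.1 h7.2) (abs_nonneg _)
      _ ≤ s y + d y := by
          rw [mul_one, abs_le]
          constructor <;> linarith
  have hFmeas : ∀ n, AEStronglyMeasurable (F (e n)) ν := fun n =>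
    ((hs.aemeasurable.sub hd.aemeasurable).mul
      (hmeas0.aemeasurable.mul (hmeas (e n)))).aestronglyMeasurable
  let g : Y → ℝ := fun y => (1 + a y)⁻¹ * (1 + a y)⁻¹
  have hg : Measurable g := hmeas0.mul hmeas0
  have hlim : Tendsto (fun n => ∫ y, F (e n) y ∂ν) atTop
      (nhds (∫ y, (s y - d y) * g y ∂ν)) := by
    refine tendsto_integral_of_dominated_convergence _ hFmeas (hs.add hd) hbound ?_
    filter_upwards [hbase] with y ⟨_, h3, h4⟩
    have h5 : Tendsto (fun n => (1 + (a y + e n * (s y - d y)))⁻¹) atTop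
        (nhds (1 + a y)⁻¹) := by
      refine Tendsto.inv₀ ?_ (by linarith)
      simpa using ((he.mul_const (s y - d y)).const_add (a y)).const_add 1
    exact (h5.const_mul _).const_mul _
  have hnonpos : ∫ y, (s y - d y) * g y ∂ν ≤ 0 :=
    le_of_tendsto' hlim fun n => hF _ (he0 n) (he1 n)
  let c : ℝ := (1 + t)⁻¹ * (1 + t)⁻¹
  have hgbound : ∀ᵐ y ∂ν, ‖g y‖ ≤ 1 := by
    filter_upwards [hbase] with y ⟨_, h3, h4⟩
    have h6 := inv_one_add_mem_Icc (h3.trans h4)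
    rw [Real.norm_of_nonneg (mul_nonneg h6.1 h6.1)]
    exact mul_le_one₀ h6.2 h6.1 h6.2
  have hsg : Integrable (fun y => s y * g y) ν :=
    hs.mul_bdd hg.aestronglyMeasurable hgbound
  have hdg : Integrable (fun y => d y * g y) ν :=
    hd.mul_bdd hg.aestronglyMeasurable hgbound
  have hsgc : Integrable (fun y => s y * (g y - c)) ν := by
    simp only [mul_sub]
    exact hsg.sub (hs.mul_const c)
  have hsgc0 : ∀ᵐ y ∂ν, 0 ≤ s y * (g y - c) := by
    filter_upwards [hbase, hst] with y ⟨h2, h3, h4⟩ h5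
    rcases le_or_gt t (a y) with h6 | h6
    · rw [h5 h6, zero_mul]
    · refine mul_nonneg h2 (sub_nonneg.2 ?_)
      have : (1 + t)⁻¹ ≤ (1 + a y)⁻¹ := inv_anti₀ (by linarith) (by linarith)
      exact mul_self_le_mul_self (by positivity) this
  have hdgc0 : ∀ᵐ y ∂ν, d y * g y ≤ d y * c := by
    filter_upwards [hbase, hdt] with y ⟨h2, h3, h4⟩ h5
    rcases lt_or_ge (a y) t with h6 | h6
    · rw [h5 h6, zero_mul, zero_mul]
    · refine mul_le_mul_of_nonneg_left ?_ h3
      have : (1 + a y)⁻¹ ≤ (1 + t)⁻¹ := inv_anti₀ (by linarith) (by linarith)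
      exact mul_self_le_mul_self (inv_one_add_mem_Icc (h3.trans h4)).1 this
  have h1 : ∫ y, d y * g y ∂ν ≤ (∫ y, d y ∂ν) * c := by
    rw [← integral_mul_const]
    exact integral_mono_ae hdg (hd.mul_const c) hdgc0
  have h2 : ∫ y, s y * (g y - c) ∂ν = ∫ y, s y * g y ∂ν - (∫ y, s y ∂ν) * c := by
    rw [← integral_mul_const, ← integral_sub hsg (hs.mul_const c)]
    simp only [mul_sub]
  have h3 : ∫ y, (s y - d y) * g y ∂ν = ∫ y, s y * g y ∂ν - ∫ y, d y * g y ∂ν := by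
    rw [← integral_sub hsg hdg]
    simp only [sub_mul]
  have hc : 0 ≤ c := by positivity
  have h4 : ∫ y, s y * (g y - c) ∂ν = 0 := by
    refine le_antisymm ?_ (integral_nonneg_of_ae hsgc0)
    have := mul_le_mul_of_nonneg_right hle hc
    linarith
  have h5 := (integral_eq_zero_iff_of_nonneg_ae hsgc0 hsgc).1 h4
  filter_upwards [h5, hbase, hst] with y h6 ⟨h7, h8, h9⟩ h10
  rcases le_or_gt t (a y) with h11 | h11
  · exact h10 h11
  · refine (mul_eq_zero.1 h6).resolve_right (sub_ne_zero.2 (ne_of_gt ?_))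
    have : (1 + t)⁻¹ < (1 + a y)⁻¹ := inv_strictAnti₀ (by linarith) (by linarith)
    exact mul_self_lt_mul_self (by positivity) this

/-- Making room for `τ₂` inside the capacity `ν` costs at most the mass of `τ₂`. -/
lemma exists_eq_add_of_fst_le {ν : Measure X} [IsFiniteMeasure ν] {τ₁ τ₂ : Measure (X × Y)}
    (h₁ : τ₁.map Prod.fst ≤ ν) (h₂ : τ₂.map Prod.fst ≤ ν) :
    ∃ τ' δ, τ₁ = τ' + δ ∧ τ₂.map Prod.fst + τ'.map Prod.fst ≤ ν ∧
      δ Set.univ ≤ τ₂ Set.univ := by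
  have hfin : IsFiniteMeasure (τ₂.map Prod.fst) := isFiniteMeasure_of_le ν h₂
  let b : X → ℝ≥0∞ := fun x => min ((τ₂.map Prod.fst).rnDeriv ν x) 1
  have hb : Measurable b := (Measure.measurable_rnDeriv _ _).min measurable_const
  have hb' : Measurable fun x => 1 - b x := measurable_const.sub hb
  have hsum : ((fun x => 1 - b x) + b) = 1 := by
    ext x
    exact tsub_add_cancel_of_le (min_le_right _ _)
  have hτ₂ : τ₂.map Prod.fst = ν.withDensity b := by
    rw [← Measure.withDensity_rnDeriv_eq _ _ (Measure.absolutelyContinuous_of_le h₂)]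
    refine withDensity_congr_ae ?_
    filter_upwards [Measure.rnDeriv_le_one_of_le h₂] with x hx
    exact (min_eq_left hx).symm
  have hmono : ∀ f : X → ℝ≥0∞, (τ₁.map Prod.fst).withDensity f ≤ ν.withDensity f := fun f =>
    Measure.le_iff.2 fun s hs => by
      rw [withDensity_apply _ hs, withDensity_apply _ hs]
      exact lintegral_mono' (Measure.restrict_mono le_rfl h₁) le_rfl
  refine ⟨τ₁.withDensity ((fun x => 1 - b x) ∘ Prod.fst), τ₁.withDensity (b ∘ Prod.fst),
    ?_, ?_, ?_⟩
  · rw [← withDensity_add_left (hb'.comp measurable_fst)]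
    have : ((fun x => 1 - b x) ∘ Prod.fst + b ∘ Prod.fst : X × Y → ℝ≥0∞) = 1 := by
      ext z
      exact congrFun hsum z.1
    rw [this, withDensity_one]
  · rw [map_withDensity_comp _ measurable_fst hb', hτ₂]
    calc ν.withDensity b + (τ₁.map Prod.fst).withDensity (fun x => 1 - b x)
        ≤ ν.withDensity b + ν.withDensity (fun x => 1 - b x) := by
          gcongr
          exact hmono _
      _ = ν := by rw [add_comm, ← withDensity_add_left hb', hsum, withDensity_one]
  · have hu : ∀ μ : Measure (X × Y), μ Set.univ = μ.map Prod.fst Set.univ := fun μ => by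
      rw [Measure.map_apply measurable_fst MeasurableSet.univ, Set.preimage_univ]
    rw [hu, hu τ₂, map_withDensity_comp _ measurable_fst hb, hτ₂]
    exact hmono b _

/-- A version of `exists_eq_add_of_fst_le` in the presence of an occupied amount `β`. -/
lemma exists_eq_add_of_add_fst_le {ν β : Measure X} [IsFiniteMeasure ν]
    {τ₁ τ₂ : Measure (X × Y)} (h₁ : β + τ₁.map Prod.fst ≤ ν) (h₂ : β + τ₂.map Prod.fst ≤ ν) :
    ∃ τ' δ, τ₁ = τ' + δ ∧ β + (τ₂.map Prod.fst + τ'.map Prod.fst) ≤ ν ∧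
      δ Set.univ ≤ τ₂ Set.univ := by
  have hβ : β ≤ ν := (Measure.le_add_right le_rfl).trans h₁
  have hfin : IsFiniteMeasure β := isFiniteMeasure_of_le ν hβ
  have hsub : ∀ μ : Measure X, β + μ ≤ ν → μ ≤ ν - β := fun μ h =>
    Measure.le_iff.2 fun s hs => by
      rw [Measure.sub_apply hs hβ]
      refine ENNReal.le_sub_of_add_le_left (measure_ne_top _ _) ?_
      exact h s
  obtain ⟨τ', δ, h, hle, hδ⟩ := exists_eq_add_of_fst_le (hsub _ h₁) (hsub _ h₂)
  refine ⟨τ', δ, h, ?_, hδ⟩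
  calc β + (τ₂.map Prod.fst + τ'.map Prod.fst) ≤ β + (ν - β) := by gcongr
    _ = ν := by rw [add_comm, Measure.sub_add_cancel_of_le hβ]

lemma ae_rnDeriv_eq_zero_of_measure_eq_zero (μ ν : Measure Y) {s : Set Y} (hs : MeasurableSet s)
    (h : μ s = 0) : ∀ᵐ y ∂ν, y ∈ s → μ.rnDeriv ν y = 0 := by
  rw [← ae_restrict_iff' hs]
  refine (lintegral_eq_zero_iff (Measure.measurable_rnDeriv μ ν)).1 ?_
  exact nonpos_iff_eq_zero.1 ((Measure.setLIntegral_rnDeriv_le s).trans h.le)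

lemma ae_rnDeriv_le_rnDeriv {μ ρ ν : Measure Y} [IsFiniteMeasure ρ] [SigmaFinite ν] (h : μ ≤ ρ) :
    ∀ᵐ y ∂ν, μ.rnDeriv ν y ≤ ρ.rnDeriv ν y := by
  have : IsFiniteMeasure μ := isFiniteMeasure_of_le ρ h
  filter_upwards [Measure.rnDeriv_add' (ρ - μ) μ ν] with y hy
  rw [Measure.sub_add_cancel_of_le h] at hy
  rw [hy, Pi.add_apply]
  exact le_add_self

lemma map_snd_univ (μ : Measure (X × Y)) : μ.map Prod.snd Set.univ = μ Set.univ := by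
  rw [Measure.map_apply measurable_snd MeasurableSet.univ, Set.preimage_univ]

/-- A minimizer of the harmonic cost admits no improving exchange from densities at least `t` to
densities below `t`. -/
lemma eq_zero_of_exchange {E : Set (X × Y)} {νX : Measure X} {νY : Measure Y} [IsFiniteMeasure νX]
    [IsFiniteMeasure νY] {σ ω τ δ : Measure (X × Y)} (hσ : IsSubplan E νX σ)
    (hσY : σ.map Prod.snd ≪ νY)
    (hmin : ∀ κ, IsSubplan E νX κ →
      harmonicCost νY (σ.map Prod.snd) ≤ harmonicCost νY (κ.map Prod.snd))
    (hω : IsSubplan E νX ω) (hωσ : ω + δ = σ + τ) (hδσ : δ ≤ σ) (hτω : τ ≤ ω)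
    (hτY : τ.map Prod.snd ≪ νY) (hmass : δ Set.univ ≤ τ Set.univ) {t : ℝ} (ht : 0 ≤ t)
    (hτt : τ.map Prod.snd {y | (σ.map Prod.snd).rnDeriv νY y < ENNReal.ofReal t}ᶜ = 0)
    (hδt : δ.map Prod.snd {y | (σ.map Prod.snd).rnDeriv νY y < ENNReal.ofReal t} = 0) :
    τ = 0 := by
  have hfσ : IsFiniteMeasure σ := hσ.isFiniteMeasure
  have hfω : IsFiniteMeasure ω := hω.isFiniteMeasure
  have hfτ : IsFiniteMeasure τ := isFiniteMeasure_of_le ω hτω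
  have hfδ : IsFiniteMeasure δ := isFiniteMeasure_of_le σ hδσ
  have hδσY : δ.map Prod.snd ≤ σ.map Prod.snd := Measure.map_mono hδσ measurable_snd
  have hδY : δ.map Prod.snd ≪ νY := (Measure.absolutelyContinuous_of_le hδσY).trans hσY
  let r := (σ.map Prod.snd).rnDeriv νY
  let s := (τ.map Prod.snd).rnDeriv νY
  let d := (δ.map Prod.snd).rnDeriv νY
  have hr : Measurable r := Measure.measurable_rnDeriv _ _
  have hrt : ∀ᵐ y ∂νY, r y < ∞ := Measure.rnDeriv_lt_top _ _
  have hst : ∀ᵐ y ∂νY, s y < ∞ := Measure.rnDeriv_lt_top _ _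
  have hdt : ∀ᵐ y ∂νY, d y < ∞ := Measure.rnDeriv_lt_top _ _
  have hA : MeasurableSet {y | r y < ENNReal.ofReal t} := measurableSet_lt hr measurable_const
  have hs0 : ∀ᵐ y ∂νY, (s y).toReal = 0 := by
    refine ae_eq_zero_of_integral_inv_one_add_le (a := fun y => (r y).toReal)
      (d := fun y => (d y).toReal) (t := t) hr.ennreal_toReal Measure.integrable_toReal_rnDeriv
      Measure.integrable_toReal_rnDeriv (Eventually.of_forall fun _ => ENNReal.toReal_nonneg)
      (Eventually.of_forall fun _ => ENNReal.toReal_nonneg) ?_ ?_ ?_ ht ?_ ?_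
    · filter_upwards [ae_rnDeriv_le_rnDeriv (ν := νY) hδσY, hrt] with y h1 h2
      exact ENNReal.toReal_mono h2.ne h1
    · filter_upwards [ae_rnDeriv_eq_zero_of_measure_eq_zero _ νY hA.compl hτt, hrt] with y h1 h2 h3
      have h4 : s y = 0 := h1 (not_lt.2 ((ENNReal.ofReal_le_iff_le_toReal h2.ne).2 h3))
      rw [h4, ENNReal.toReal_zero]
    · filter_upwards [ae_rnDeriv_eq_zero_of_measure_eq_zero _ νY hA hδt, hrt] with y h1 h2 h3
      have h4 : d y = 0 := h1 ((ENNReal.lt_ofReal_iff_toReal_lt h2.ne).2 h3)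
      rw [h4, ENNReal.toReal_zero]
    · rw [Measure.integral_toReal_rnDeriv hτY, Measure.integral_toReal_rnDeriv hδY, Measure.real,
        Measure.real, map_snd_univ, map_snd_univ]
      exact ENNReal.toReal_mono (measure_ne_top _ _) hmass
    · intro ε h0 h1
      lift ε to ℝ≥0 using h0.le
      have hε : (1 - ε) + ε = 1 := tsub_add_cancel_of_le (NNReal.coe_le_one.1 h1.le)
      have hκ := hσ.convex hω hε
      have hadd : ((1 - ε) • σ + ε • ω) + ε • δ = σ + ε • τ := by
        rw [add_assoc, ← smul_add, hωσ, smul_add, ← add_assoc, ← add_smul, hε, one_smul]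
      have hadd' : ((1 - ε) • σ + ε • ω).map Prod.snd + ε • δ.map Prod.snd
          = σ.map Prod.snd + ε • τ.map Prod.snd := by
        rw [← Measure.map_smul, ← Measure.map_smul, ← Measure.map_add _ _ measurable_snd,
          ← Measure.map_add _ _ measurable_snd, hadd]
      have hκfin : IsFiniteMeasure ((1 - ε) • σ + ε • ω) := hκ.isFiniteMeasure
      refine (hmin _ hκ).trans_eq (integral_congr_ae ?_)
      filter_upwards [Measure.rnDeriv_add' (((1 - ε) • σ + ε • ω).map Prod.snd)
          (ε • δ.map Prod.snd) νY, Measure.rnDeriv_add' (σ.map Prod.snd) (ε • τ.map Prod.snd) νY,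
        Measure.rnDeriv_smul_left' (δ.map Prod.snd) νY ε,
        Measure.rnDeriv_smul_left' (τ.map Prod.snd) νY ε, hrt, hst, hdt,
        Measure.rnDeriv_lt_top (((1 - ε) • σ + ε • ω).map Prod.snd) νY]
        with y h2 h3 h4 h5 h6 h7 h8 h9
      change _ = ε * d y at h4
      change _ = ε * s y at h5
      rw [hadd', h3, Pi.add_apply, Pi.add_apply, h4, h5] at h2
      have h10 := congrArg ENNReal.toReal h2
      rw [ENNReal.toReal_add h6.ne (ENNReal.mul_ne_top ENNReal.coe_ne_top h7.ne),
        ENNReal.toReal_add h9.ne (ENNReal.mul_ne_top ENNReal.coe_ne_top h8.ne),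
        ENNReal.toReal_mul, ENNReal.toReal_mul, ENNReal.coe_toReal] at h10
      congr 2
      change (r y).toReal + ε * (s y).toReal = _ + ε * (d y).toReal at h10
      linarith
  have hs : s =ᵐ[νY] 0 := by
    filter_upwards [hs0, hst] with y h1 h2
    exact ((ENNReal.toReal_eq_zero_iff _).1 h1).resolve_right h2.ne
  refine Measure.measure_univ_eq_zero.1 ?_
  rw [← map_snd_univ, ← Measure.lintegral_rnDeriv hτY]
  exact (lintegral_congr_ae hs).trans lintegral_zero

/-- A minimizer of the harmonic cost carries the largest possible mass below each level. -/
lemma measure_lt_le_of_forall_harmonicCost_le {E : Set (X × Y)} {νX : Measure X} {νY : Measure Y}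
    [IsFiniteMeasure νX] [IsFiniteMeasure νY] {σ τ : Measure (X × Y)} (hσ : IsSubplan E νX σ)
    (hσY : σ.map Prod.snd ≪ νY)
    (hmin : ∀ κ, IsSubplan E νX κ →
      harmonicCost νY (σ.map Prod.snd) ≤ harmonicCost νY (κ.map Prod.snd))
    (hτ : IsSubplan E νX τ) (hτY : τ.map Prod.snd ≪ νY) {t : ℝ} (ht : 0 ≤ t) :
    τ (Prod.snd ⁻¹' {y | (σ.map Prod.snd).rnDeriv νY y < ENNReal.ofReal t}) ≤
      σ (Prod.snd ⁻¹' {y | (σ.map Prod.snd).rnDeriv νY y < ENNReal.ofReal t}) := by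
  set A : Set Y := {y | (σ.map Prod.snd).rnDeriv νY y < ENNReal.ofReal t} with hAdef
  have hA : MeasurableSet A := measurableSet_lt (Measure.measurable_rnDeriv _ _) measurable_const
  have hB : MeasurableSet (Prod.snd ⁻¹' A : Set (X × Y)) := measurable_snd hA
  set B : Set (X × Y) := Prod.snd ⁻¹' A with hBdef
  have hsplit : σ.restrict B + σ.restrict Bᶜ = σ := Measure.restrict_add_restrict_compl hB
  have hσB : IsSubplan E νX (σ.restrict B) := hσ.mono Measure.restrict_le_self
  have hτB : IsSubplan E νX (τ.restrict B) := hτ.mono Measure.restrict_le_self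
  obtain ⟨τ', δ, hτδ, hle, hδ⟩ := exists_eq_add_of_fst_le hτB.fst_le hσB.fst_le
  have hle' : (σ.restrict B).map Prod.fst + (σ.restrict Bᶜ).map Prod.fst ≤ νX := by
    rw [← Measure.map_add _ _ measurable_fst, hsplit]
    exact hσ.fst_le
  obtain ⟨σ', δ', hσδ, hω, hδ'⟩ := exists_eq_add_of_add_fst_le hle' hle
  have hτ'B : τ' ≤ τ.restrict B := hτδ ▸ Measure.le_add_right le_rfl
  have hτ' : IsSubplan E νX τ' := hτB.mono hτ'B
  have hσ'B : σ' ≤ σ.restrict Bᶜ := hσδ ▸ Measure.le_add_right le_rfl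
  have hδ'B : δ' ≤ σ.restrict Bᶜ := hσδ ▸ Measure.le_add_left le_rfl
  have hσ' : IsSubplan E νX σ' := hσ.mono (hσ'B.trans Measure.restrict_le_self)
  have hzero : τ' = 0 := by
    refine eq_zero_of_exchange (ω := σ.restrict B + (τ' + σ')) (δ := δ') hσ hσY hmin ⟨?_, ?_⟩ ?_
      (hδ'B.trans Measure.restrict_le_self)
      ((Measure.le_add_right le_rfl).trans (Measure.le_add_left le_rfl))
      ((Measure.absolutelyContinuous_of_le (Measure.map_mono
        (hτ'B.trans Measure.restrict_le_self) measurable_snd)).trans hτY) hδ' ht ?_ ?_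
    · simp [hσB.null, hτ'.null, hσ'.null]
    · rwa [Measure.map_add _ _ measurable_fst, Measure.map_add _ _ measurable_fst]
    · rw [hσδ] at hsplit
      conv_rhs => rw [← hsplit]
      abel
    · rw [Measure.map_apply measurable_snd hA.compl]
      refine nonpos_iff_eq_zero.1 ((hτ'B _).trans ?_)
      rw [Measure.restrict_apply (measurable_snd hA.compl), Set.preimage_compl,
        Set.compl_inter_self, measure_empty]
    · rw [Measure.map_apply measurable_snd hA]
      refine nonpos_iff_eq_zero.1 ((hδ'B _).trans ?_)
      rw [Measure.restrict_apply hB, Set.inter_compl_self, measure_empty]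
  rw [hzero, zero_add] at hτδ
  rw [← Measure.restrict_apply_univ, ← Measure.restrict_apply_univ (μ := σ), hτδ]
  exact hδ

/-- Truncated density mass of a plan is attained by a feasible capped subplan. -/
lemma lintegral_min_rnDeriv_le_Fit {E : Set (X × Y)} {νX : Measure X} {νY : Measure Y}
    [IsFiniteMeasure νX] {π : Measure (X × Y)} (hπ : π ∈ Plans E νX) (t : ℝ) :
    ∫⁻ y, min ((π.map Prod.snd).rnDeriv νY y) (ENNReal.ofReal t) ∂νY ≤ Fit E νX νY t := by
  obtain ⟨hfin, hE, hfst⟩ := hπ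
  let m : Y → ℝ≥0∞ := fun y => min ((π.map Prod.snd).rnDeriv νY y) (ENNReal.ofReal t)
  have hq : νY.withDensity m ≤ π.map Prod.snd :=
    (withDensity_mono (Eventually.of_forall fun y => min_le_left _ _)).trans
      (Measure.withDensity_rnDeriv_le _ _)
  obtain ⟨σ, hσ, hσm⟩ := exists_le_map_eq π measurable_snd hq
  have hσsub : IsSubplan E νX σ := IsSubplan.mono ⟨hE, hfst.le⟩ hσ
  have hmass : ∫⁻ y, m y ∂νY = σ Set.univ := by
    rw [← map_snd_univ, hσm, withDensity_apply _ MeasurableSet.univ, Measure.restrict_univ]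
  refine hmass.trans_le (le_iSup₂_of_le σ ⟨hσsub.isFiniteMeasure, hσsub.null, hσsub.fst_le, ?_⟩
    le_rfl)
  rw [hσm, ← withDensity_const]
  exact withDensity_mono (Eventually.of_forall fun y => min_le_right _ _)

/-- The truncated densities of a minimizer of the harmonic cost dominate the maximal feasible
masses. -/
lemma Fit_le_lintegral_min_rnDeriv {E : Set (X × Y)} {νX : Measure X} {νY : Measure Y}
    [IsFiniteMeasure νX] [IsFiniteMeasure νY] {σ : Measure (X × Y)} (hσ : IsSubplan E νX σ)
    (hσY : σ.map Prod.snd ≪ νY)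
    (hmin : ∀ κ, IsSubplan E νX κ →
      harmonicCost νY (σ.map Prod.snd) ≤ harmonicCost νY (κ.map Prod.snd)) {t : ℝ} (ht : 0 ≤ t) :
    Fit E νX νY t ≤
      ∫⁻ y, min ((σ.map Prod.snd).rnDeriv νY y) (ENNReal.ofReal t) ∂νY := by
  have hfσ : IsFiniteMeasure σ := hσ.isFiniteMeasure
  refine iSup₂_le fun τ hτ => ?_
  obtain ⟨-, hτE, hτX, hτY⟩ := hτ
  let r := (σ.map Prod.snd).rnDeriv νY
  let A : Set Y := {y | r y < ENNReal.ofReal t}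
  have hA : MeasurableSet A := measurableSet_lt (Measure.measurable_rnDeriv _ _) measurable_const
  have hτac : τ.map Prod.snd ≪ νY :=
    (Measure.absolutelyContinuous_of_le hτY).trans Measure.smul_absolutelyContinuous
  have h1 : τ (Prod.snd ⁻¹' A) ≤ σ (Prod.snd ⁻¹' A) :=
    measure_lt_le_of_forall_harmonicCost_le hσ hσY hmin ⟨hτE, hτX⟩ hτac ht
  have h2 : σ (Prod.snd ⁻¹' A) = ∫⁻ y in A, r y ∂νY := by
    rw [Measure.setLIntegral_rnDeriv hσY, Measure.map_apply measurable_snd hA]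
  have h3 : τ (Prod.snd ⁻¹' A)ᶜ ≤ ∫⁻ _ in Aᶜ, ENNReal.ofReal t ∂νY := by
    rw [setLIntegral_const, ← Set.preimage_compl, ← Measure.map_apply measurable_snd hA.compl]
    exact hτY _
  rw [← measure_add_measure_compl (measurable_snd hA), ← lintegral_add_compl _ hA]
  refine add_le_add ((h1.trans h2.le).trans_eq ?_) (h3.trans_eq ?_)
  · exact setLIntegral_congr_fun hA fun y hy => (min_eq_left (le_of_lt hy)).symm
  · refine setLIntegral_congr_fun hA.compl fun y (hy : ¬ r y < ENNReal.ofReal t) => ?_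
    exact (min_eq_right (not_lt.1 hy)).symm

theorem exists_level_opt_maximin
    [TopologicalSpace X] [PolishSpace X] [BorelSpace X]
    [TopologicalSpace Y] [PolishSpace Y] [BorelSpace Y]
    (E : Set (X × Y)) (hE : IsClosed E)
    (νX : Measure X) (νY : Measure Y) [IsFiniteMeasure νX] [IsFiniteMeasure νY]
    (hνX : 0 < νX Set.univ) (hνY : 0 < νY Set.univ)
    (hNbhdX : ∀ x : X, ∃ y : Y, (x, y) ∈ E) (hNbhdY : ∀ y : Y, ∃ x : X, (x, y) ∈ E) :
    ∃ π ∈ Plans E νX, LevelOptMaximin E νX νY π := by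
  obtain ⟨σ, hσ, hσY, hmin⟩ := exists_forall_harmonicCost_le hE νX νY
  have hfσ : IsFiniteMeasure σ := hσ.isFiniteMeasure
  obtain ⟨κ, hκE, hκ⟩ := exists_plan hE hNbhdX (νX - σ.map Prod.fst)
  have hκfin : IsFiniteMeasure κ := by
    have : IsFiniteMeasure (κ.map Prod.fst) := hκ ▸ inferInstance
    exact Measure.isFiniteMeasure_of_map measurable_fst.aemeasurable
  have hπ : σ + κ ∈ Plans E νX := by
    refine ⟨inferInstance, by simp [hσ.null, hκE], ?_⟩
    rw [Measure.map_add _ _ measurable_fst, hκ, add_comm, Measure.sub_add_cancel_of_le hσ.fst_le]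
  refine ⟨σ + κ, hπ, fun t ht => (lintegral_min_rnDeriv_le_Fit hπ t).antisymm
    ((Fit_le_lintegral_min_rnDeriv hσ hσY hmin ht.le).trans (lintegral_mono_ae ?_))⟩
  filter_upwards [ae_rnDeriv_le_rnDeriv (ν := νY)
    (Measure.map_mono (Measure.le_add_right (le_refl σ) : σ ≤ σ + κ) measurable_snd)] with y hy
  exact min_le_min_right _ hy
end
end

section
/- Fix ι ∈ {0,1} and let θ : [0,∞) → ℝ ∪ {+∞} be proper, convex, and lower semicontinuous. If π* ∈ Π_ι is level-optimal maximin, then D_θ(ν_ῑ^{(π*)}‖ν_ῑ) = inf{D_θ(ν_ῑ^{(π)}‖ν_ῑ) : π ∈ Π_ι}; that is, π* is optimal for the D_θ-closest one-sided refinement problem on side ι. -/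
/- STATEMENT 9: Level-optimal maximin implies `θ`-optimality
(Theorem `level_opt_maximin_implies_theta_opt`).  The side `ι ∈ {0,1}` is formalized
abstractly: `X` plays the role of `Ω_ι` and `Y` of `Ω_ῑ`. -/

open MeasureTheory ProbabilityTheory Filter
open scoped ENNReal NNReal

noncomputable section

variable {X Y : Type} [MeasurableSpace X] [MeasurableSpace Y]

/-- The piecewise linear interpolation of `f` at the nodes `0, h, …, K * h`, constant
beyond `K * h`, written as a combination of the truncations `min s (k * h)`. -/
def truncatedInterp (f : ℝ → ℝ) (h : ℝ) (K : ℕ) (s : ℝ) : ℝ :=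
  f 0 + ∑ k ∈ Finset.range K,
    (f ((k + 1 : ℕ) * h) - f (k * h)) / h * (min s ((k + 1 : ℕ) * h) - min s (k * h))

lemma abs_truncatedInterp_sub_le {f : ℝ → ℝ} {L h s : ℝ}
    (hf : ∀ x y, |f x - f y| ≤ L * |x - y|) (hh : 0 < h) (hs : 0 ≤ s) (K : ℕ) :
    |truncatedInterp f h K s - f (min s (K * h))| ≤ 2 * L * h ∧
      (K * h ≤ s → truncatedInterp f h K s = f (K * h)) := by
  have hL : 0 ≤ L := by simpa using (abs_nonneg _).trans (hf 1 0)
  induction K with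
  | zero => simpa [truncatedInterp, hs] using by positivity
  | succ K ih =>
    have hstep : truncatedInterp f h (K + 1) s = truncatedInterp f h K s +
        (f ((K + 1 : ℕ) * h) - f (K * h)) / h * (min s ((K + 1 : ℕ) * h) - min s (K * h)) := by
      simp only [truncatedInterp, Finset.sum_range_succ, add_assoc]
    have hK : ((K + 1 : ℕ) : ℝ) * h = K * h + h := by push_cast; ring
    rw [hstep, hK]
    rcases lt_or_ge s (K * h) with h1 | h1
    · have h2 : s ≤ K * h + h := by linarith
      refine ⟨?_, fun h3 => absurd h3 (by linarith)⟩
      simpa [min_eq_left h1.le, min_eq_left h2] using ih.1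
    · rw [ih.2 h1, min_eq_right h1]
      rcases le_or_gt (K * h + h) s with h2 | h2
      · rw [min_eq_right h2]
        have h3 : f (K * h) + (f (K * h + h) - f (K * h)) / h * (K * h + h - K * h)
            = f (K * h + h) := by field_simp; ring
        rw [h3]
        exact ⟨by simpa using by positivity, fun _ => rfl⟩
      · refine ⟨?_, fun h3 => absurd h3 (by linarith)⟩
        rw [min_eq_left h2.le]
        have h3 : |f (K * h) - f s| ≤ L * h :=
          (hf _ _).trans (by gcongr; rw [abs_le]; constructor <;> linarith)
        have h4 : |(f (K * h + h) - f (K * h)) / h * (s - K * h)| ≤ L * h := by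
          rw [abs_mul, abs_div, abs_of_pos hh, abs_of_nonneg (sub_nonneg.2 h1)]
          have h5 : |f (K * h + h) - f (K * h)| / h ≤ L := by
            rw [div_le_iff₀ hh]
            simpa [abs_of_pos hh] using hf (K * h + h) (K * h)
          gcongr
          linarith
        calc |f (K * h) + (f (K * h + h) - f (K * h)) / h * (s - K * h) - f s|
            = |(f (K * h) - f s) + (f (K * h + h) - f (K * h)) / h * (s - K * h)| := by ring_nf
          _ ≤ _ := abs_add_le _ _
          _ ≤ 2 * L * h := by linarith

lemma sum_mul_sub_le_of_monotone {c A : ℕ → ℝ} (hc : Monotone c) (hA : ∀ k, 0 ≤ A k)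
    (hA0 : A 0 = 0) (K : ℕ) :
    ∑ k ∈ Finset.range K, c k * (A (k + 1) - A k) ≤ c K * A K := by
  induction K with
  | zero => simp [hA0]
  | succ K ih =>
    rw [Finset.sum_range_succ]
    nlinarith [mul_le_mul_of_nonneg_right (hc (Nat.le_add_right K 1)) (hA (K + 1))]

lemma tendsto_integral_truncatedInterp {Ω : Type*} [MeasurableSpace Ω] {ν : Measure Ω}
    [IsFiniteMeasure ν] {p : Ω → ℝ} (hp0 : ∀ x, 0 ≤ p x) (hp : Integrable p ν)
    {f : ℝ → ℝ} {L : ℝ} (hf : ∀ x y, |f x - f y| ≤ L * |x - y|) :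
    Tendsto (fun m : ℕ => ∫ x, truncatedInterp f (1 / (m + 1)) ((m + 1) * (m + 1)) (p x) ∂ν)
      atTop (nhds (∫ x, f (p x) ∂ν)) := by
  have hL : 0 ≤ L := by simpa using (abs_nonneg _).trans (hf 1 0)
  have hKh : ∀ m : ℕ, (((m + 1) * (m + 1) : ℕ) : ℝ) * (1 / (m + 1)) = m + 1 := fun m => by
    push_cast; field_simp
  have hpos : ∀ m : ℕ, (0 : ℝ) < 1 / (m + 1) := fun m => by positivity
  have herr := fun (m : ℕ) x =>
    (abs_truncatedInterp_sub_le hf (hpos m) (hp0 x) ((m + 1) * (m + 1))).1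
  simp only [hKh] at herr
  refine tendsto_integral_of_dominated_convergence (fun x => |f 0| + L * p x + 2 * L)
    (fun m => ?_) ?_ (fun m => .of_forall fun x => ?_) (.of_forall fun x => ?_)
  · have : Continuous (truncatedInterp f (1 / (m + 1)) ((m + 1) * (m + 1))) := by
      unfold truncatedInterp; fun_prop
    exact this.comp_aestronglyMeasurable hp.1
  · exact ((integrable_const _).add (hp.const_mul L)).add (integrable_const _)
  · have h1 : |f (min (p x) (m + 1)) - f 0| ≤ L * p x := by
      refine (hf _ _).trans ?_
      have : 0 ≤ min (p x) ((m : ℝ) + 1) := le_min (hp0 x) (by positivity)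
      rw [sub_zero, abs_of_nonneg this]
      gcongr
      exact min_le_left _ _
    have h2 : 2 * L * (1 / ((m : ℝ) + 1)) ≤ 2 * L := by
      have : 1 / ((m : ℝ) + 1) ≤ 1 := by
        rw [div_le_one (by positivity)]; linarith [(m.cast_nonneg : (0 : ℝ) ≤ m)]
      nlinarith
    have h3 := herr m x
    rw [Real.norm_eq_abs]
    rw [abs_le] at *
    constructor <;> linarith [le_abs_self (f 0), neg_abs_le (f 0)]
  · rw [tendsto_iff_dist_tendsto_zero]
    have h0 : Tendsto (fun m : ℕ => 2 * L * (1 / ((m : ℝ) + 1))) atTop (nhds 0) := by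
      simpa using tendsto_one_div_add_atTop_nhds_zero_nat.const_mul (2 * L)
    refine squeeze_zero' (.of_forall fun _ => dist_nonneg) ?_ h0
    filter_upwards [eventually_ge_atTop ⌈p x⌉₊] with m hm
    have hm' : p x ≤ m + 1 := by
      have h1 : (⌈p x⌉₊ : ℝ) ≤ m := by exact_mod_cast hm
      linarith [Nat.le_ceil (p x)]
    simpa [Real.dist_eq, min_eq_left hm'] using herr m x

lemma integral_truncatedInterp {Ω : Type*} [MeasurableSpace Ω] {ν : Measure Ω}
    [IsFiniteMeasure ν] {p : Ω → ℝ} (hp : Integrable p ν) (f : ℝ → ℝ) (h : ℝ) (K : ℕ) :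
    ∫ x, truncatedInterp f h K (p x) ∂ν = ∫ _, f 0 ∂ν + ∑ k ∈ Finset.range K,
      (f ((k + 1 : ℕ) * h) - f (k * h)) / h *
        (∫ x, min (p x) ((k + 1 : ℕ) * h) ∂ν - ∫ x, min (p x) (k * h) ∂ν) := by
  have hmin : ∀ t : ℝ, Integrable (fun x => min (p x) t) ν :=
    fun t => hp.inf (integrable_const t)
  have hterm : ∀ k : ℕ, Integrable (fun x => (f ((k + 1 : ℕ) * h) - f (k * h)) / h *
      (min (p x) ((k + 1 : ℕ) * h) - min (p x) (k * h))) ν :=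
    fun k => ((hmin _).sub (hmin _)).const_mul _
  unfold truncatedInterp
  rw [integral_add (integrable_const _) (integrable_finsetSum _ fun k _ => hterm k),
    integral_finsetSum _ fun k _ => hterm k]
  congr 1
  refine Finset.sum_congr rfl fun k _ => ?_
  rw [integral_const_mul, integral_sub (hmin _) (hmin _)]

lemma integral_comp_le_of_integral_min_le {Ω : Type*} [MeasurableSpace Ω] {ν : Measure Ω}
    [IsFiniteMeasure ν] {p q : Ω → ℝ} (hp0 : ∀ x, 0 ≤ p x) (hq0 : ∀ x, 0 ≤ q x)
    (hp : Integrable p ν) (hq : Integrable q ν)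
    (hmin : ∀ t : ℝ, 0 < t → ∫ x, min (p x) t ∂ν ≤ ∫ x, min (q x) t ∂ν)
    {f : ℝ → ℝ} {L d : ℝ} (hconv : ConvexOn ℝ Set.univ f)
    (hf : ∀ x y, |f x - f y| ≤ L * |x - y|) (hd : ∀ s v, 0 ≤ s → 0 ≤ v → f (s + v) ≤ f s + d * v) :
    ∫ x, f (q x) ∂ν ≤ ∫ x, f (p x) ∂ν + d * (∫ x, q x ∂ν - ∫ x, p x ∂ν) := by
  have hid : ∀ x y : ℝ, |id x - id y| ≤ 1 * |x - y| := by simp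
  have hP := tendsto_integral_truncatedInterp hp0 hp hf
  have hQ := tendsto_integral_truncatedInterp hq0 hq hf
  have hP' := tendsto_integral_truncatedInterp hp0 hp hid
  have hQ' := tendsto_integral_truncatedInterp hq0 hq hid
  refine le_of_tendsto_of_tendsto' hQ (hP.add ((hQ'.sub hP').const_mul d)) fun m => ?_
  set h : ℝ := 1 / (m + 1) with hh
  have hpos : 0 < h := by positivity
  set K := (m + 1) * (m + 1)
  simp only [integral_truncatedInterp hp, integral_truncatedInterp hq]
  set A : ℕ → ℝ := fun k => ∫ x, min (q x) (k * h) ∂ν - ∫ x, min (p x) (k * h) ∂ν with hA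
  set c : ℕ → ℝ := fun k => (f ((k + 1 : ℕ) * h) - f (k * h)) / h with hc
  have hA0 : A 0 = 0 := by simp [hA, hp0, hq0]
  have hAnn : ∀ k, 0 ≤ A k := by
    intro k
    rcases k.eq_zero_or_pos with rfl | hk
    · exact hA0.ge
    · exact sub_nonneg.2 (hmin _ (by positivity))
  have hcmono : Monotone c := by
    refine monotone_nat_of_le_succ fun k => ?_
    have h1 := hconv.slope_mono_adjacent (x := k * h) (y := (k + 1 : ℕ) * h)
      (z := (k + 1 + 1 : ℕ) * h) trivial trivial (by push_cast; linarith) (by push_cast; linarith)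
    have e1 : ((k + 1 : ℕ) : ℝ) * h - k * h = h := by push_cast; ring
    have e2 : ((k + 1 + 1 : ℕ) : ℝ) * h - (k + 1 : ℕ) * h = h := by push_cast; ring
    rwa [e1, e2] at h1
  have hcd : ∀ k, c k ≤ d := by
    intro k
    have h1 := hd (k * h) h (by positivity) hpos.le
    rw [hc, div_le_iff₀ hpos]
    have e1 : ((k + 1 : ℕ) : ℝ) * h = k * h + h := by push_cast; ring
    rw [e1]; linarith
  have key := (sum_mul_sub_le_of_monotone hcmono hAnn hA0 K).trans
    (mul_le_mul_of_nonneg_right (hcd K) (hAnn K))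
  have e1 : ∀ k : ℕ, (id (((k + 1 : ℕ) : ℝ) * h) - id ((k : ℝ) * h)) / h = 1 := fun k => by
    simp only [id]; push_cast; field_simp; ring
  have e2 : ∑ k ∈ Finset.range K, (A (k + 1) - A k) = A K := by
    rw [Finset.sum_range_sub, hA0, sub_zero]
  simp only [e1, one_mul]
  rw [add_sub_add_left_eq_sub, ← Finset.sum_sub_distrib, add_assoc]
  have e3 : ∑ k ∈ Finset.range K, ((∫ x, min (q x) ((k + 1 : ℕ) * h) ∂ν - ∫ x, min (q x) (k * h) ∂ν)
      - (∫ x, min (p x) ((k + 1 : ℕ) * h) ∂ν - ∫ x, min (p x) (k * h) ∂ν)) = A K := by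
    rw [← e2]; exact Finset.sum_congr rfl fun k _ => by simp only [hA]; ring
  rw [e3]
  have e4 : ∑ k ∈ Finset.range K, c k * (A (k + 1) - A k) =
      ∑ k ∈ Finset.range K, c k * (∫ x, min (q x) ((k + 1 : ℕ) * h) ∂ν - ∫ x, min (q x) (k * h) ∂ν)
      - ∑ k ∈ Finset.range K,
        c k * (∫ x, min (p x) ((k + 1 : ℕ) * h) ∂ν - ∫ x, min (p x) (k * h) ∂ν) := by
    rw [← Finset.sum_sub_distrib]
    exact Finset.sum_congr rfl fun k _ => by simp only [hA]; ring
  linarith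

namespace ProperConvexLSCOn

variable {θ : ℝ → EReal}

lemma coe_toReal_eq (hθ : ProperConvexLSCOn θ) {u : ℝ} (hu : 0 ≤ u) (hu' : θ u ≠ ⊤) :
    ((θ u).toReal : EReal) = θ u :=
  EReal.coe_toReal hu' (hθ.ne_bot u hu)

lemma convex_coe (hθ : ProperConvexLSCOn θ) {x y a b : ℝ} (hx : 0 ≤ x) (hy : 0 ≤ y)
    (hx' : θ x ≠ ⊤) (hy' : θ y ≠ ⊤) (ha : 0 ≤ a) (hb : 0 ≤ b) (hab : a + b = 1) :
    θ (a * x + b * y) ≤ ((a * (θ x).toReal + b * (θ y).toReal : ℝ) : EReal) := by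
  have := hθ.convex x y a b hx hy ha hb hab
  rwa [← hθ.coe_toReal_eq hx hx', ← hθ.coe_toReal_eq hy hy', ← EReal.coe_mul, ← EReal.coe_mul,
    ← EReal.coe_add] at this

lemma exists_affine_le (hθ : ProperConvexLSCOn θ) :
    ∃ A B : ℝ, 0 ≤ B ∧ ∀ u, 0 ≤ u → ((A - B * u : ℝ) : EReal) ≤ θ u := by
  obtain ⟨z, hz, hz'⟩ := hθ.exists_ne_top
  set g : ℝ := (θ z).toReal
  have hg : (g : EReal) = θ z := hθ.coe_toReal_eq hz hz'
  have hlt : ((g - 1 : ℝ) : EReal) < θ z := by rw [← hg]; exact_mod_cast sub_one_lt g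
  obtain ⟨δ, hδ, hball⟩ := Metric.mem_nhdsWithin_iff.1 (hθ.lsc z hz _ hlt)
  obtain ⟨ε, hε, hεδ⟩ := exists_between hδ
  have hnear : ∀ u, 0 ≤ u → |u - z| ≤ ε → ((g - 1 : ℝ) : EReal) < θ u := fun u hu hu' =>
    hball ⟨by rw [Metric.mem_ball, Real.dist_eq]; linarith, hu⟩
  refine ⟨g - 1 - z / ε, 1 / ε, by positivity, fun u hu => ?_⟩
  by_cases hu' : θ u = ⊤
  · rw [hu']; exact le_top
  have habs : |u - z| ≤ u + z := by rw [abs_le]; constructor <;> linarith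
  have hle : g - 1 - z / ε - 1 / ε * u ≤ g - 1 - |u - z| / ε := by
    have : |u - z| / ε ≤ (u + z) / ε := by gcongr
    have e : (u + z) / ε = z / ε + 1 / ε * u := by ring
    linarith
  refine le_trans (EReal.coe_le_coe_iff.2 hle) ?_
  rcases le_or_gt |u - z| ε with h | h
  · refine le_trans (EReal.coe_le_coe_iff.2 ?_) (hnear u hu h).le
    have : 0 ≤ |u - z| / ε := by positivity
    linarith
  · have hpos : 0 < |u - z| := hε.trans h
    set l := ε / |u - z| with hl
    have hl0 : 0 < l := by positivity
    have hl1 : l ≤ 1 := (div_le_one hpos).2 h.le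
    have hc := hθ.convex_coe hz hu hz' hu' (sub_nonneg.2 hl1) hl0.le (by ring)
    have hw : 0 ≤ (1 - l) * z + l * u :=
      add_nonneg (mul_nonneg (sub_nonneg.2 hl1) hz) (mul_nonneg hl0.le hu)
    have hw' : |(1 - l) * z + l * u - z| ≤ ε := by
      have : (1 - l) * z + l * u - z = l * (u - z) := by ring
      rw [this, abs_mul, abs_of_pos hl0, hl, div_mul_cancel₀ _ hpos.ne']
    have h3 := EReal.coe_lt_coe_iff.1 ((hnear _ hw hw').trans_le hc)
    rw [← hθ.coe_toReal_eq hu hu', EReal.coe_le_coe_iff]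
    have h4 : l * (g - (θ u).toReal) < 1 := by
      have : g = (θ z).toReal := rfl
      rw [← this] at h3
      linarith
    have h5 : |u - z| / ε = 1 / l := by rw [hl, one_div_div]
    have h6 : g - (θ u).toReal < 1 / l := by rw [lt_div_iff₀ hl0]; linarith
    rw [h5]; linarith

lemma add_le_of_recessionSlope_lt (hθ : ProperConvexLSCOn θ) {e : ℝ} (he : recessionSlope θ < e)
    {u v : ℝ} (hu : 0 ≤ u) (hu' : θ u ≠ ⊤) (hv : 0 ≤ v) :
    θ (u + v) ≤ (((θ u).toReal + e * v : ℝ) : EReal) := by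
  have hev := Filter.eventually_lt_of_limsup_lt he
  have hbound : ∀ᶠ t : ℝ in atTop, θ (u + v) ≤
      (((1 - v / (t - u)) * (θ u).toReal + v * e * (t / (t - u)) : ℝ) : EReal) := by
    filter_upwards [hev, eventually_gt_atTop (u + v)] with t ht htuv
    have ht0 : 0 < t := by linarith
    have htu : 0 < t - u := by linarith
    have htop : θ t ≠ ⊤ := by
      intro h
      rw [h, EReal.top_mul_coe_of_pos (inv_pos.2 ht0)] at ht
      exact not_top_lt ht
    rw [← hθ.coe_toReal_eq ht0.le htop, ← EReal.coe_mul, EReal.coe_lt_coe_iff,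
      ← div_eq_mul_inv, div_lt_iff₀ ht0] at ht
    have hl : v / (t - u) ≤ 1 := by rw [div_le_one htu]; linarith
    have hc := hθ.convex_coe hu ht0.le hu' htop (sub_nonneg.2 hl) (div_nonneg hv htu.le) (by ring)
    have e1 : (1 - v / (t - u)) * u + v / (t - u) * t = u + v := by field_simp; ring
    rw [e1] at hc
    refine hc.trans (EReal.coe_le_coe_iff.2 ?_)
    have : v / (t - u) * (θ t).toReal ≤ v / (t - u) * (e * t) :=
      mul_le_mul_of_nonneg_left ht.le (div_nonneg hv htu.le)
    have e2 : v * e * (t / (t - u)) = v / (t - u) * (e * t) := by ring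
    rw [e2]; linarith
  have h0 : Tendsto (fun t : ℝ => t - u) atTop atTop := tendsto_atTop_add_const_right _ _ tendsto_id
  have h1 : Tendsto (fun t : ℝ => v / (t - u)) atTop (nhds 0) := tendsto_const_nhds.div_atTop h0
  have h2 : Tendsto (fun t : ℝ => t / (t - u)) atTop (nhds 1) := by
    have h3 : Tendsto (fun t : ℝ => 1 + u / (t - u)) atTop (nhds 1) := by
      simpa using (tendsto_const_nhds (x := (1 : ℝ))).add
        (tendsto_const_nhds (x := u).div_atTop h0)
    refine h3.congr' ?_
    filter_upwards [eventually_gt_atTop u] with t ht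
    have : t - u ≠ 0 := by linarith
    field_simp; ring
  have hlim := ((tendsto_const_nhds (x := (1 : ℝ))).sub h1).mul_const (θ u).toReal |>.add
    (h2.const_mul (v * e))
  have hval : (1 - 0) * (θ u).toReal + v * e * 1 = (θ u).toReal + e * v := by ring
  rw [hval] at hlim
  exact ge_of_tendsto (continuous_coe_real_ereal.continuousAt.tendsto.comp hlim) hbound

end ProperConvexLSCOn

/-- The Pasch–Hausdorff envelope of `θ` with slope `n`, i.e. the infimal convolution of `θ`
with `n * |·|`. -/
def lipschitzEnvelope (θ : ℝ → EReal) (n s : ℝ) : ℝ :=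
  ⨅ u : {u : ℝ // 0 ≤ u ∧ θ u ≠ ⊤}, ((θ u).toReal + n * |s - u|)

section Envelope

variable {θ : ℝ → EReal} {A B n : ℝ}

lemma le_toReal_add_mul_abs (hθ : ProperConvexLSCOn θ) (hB : 0 ≤ B)
    (hlow : ∀ u, 0 ≤ u → ((A - B * u : ℝ) : EReal) ≤ θ u) (s : ℝ) {u : ℝ} (hu : 0 ≤ u)
    (hu' : θ u ≠ ⊤) :
    A - B * s + (n - B) * |s - u| ≤ (θ u).toReal + n * |s - u| := by
  have h1 := hlow u hu
  rw [← hθ.coe_toReal_eq hu hu', EReal.coe_le_coe_iff] at h1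
  nlinarith [mul_le_mul_of_nonneg_left (neg_abs_le (s - u)) hB]

lemma le_lipschitzEnvelope_aux (hθ : ProperConvexLSCOn θ) (hB : 0 ≤ B)
    (hlow : ∀ u, 0 ≤ u → ((A - B * u : ℝ) : EReal) ≤ θ u) (hn : B ≤ n) (s : ℝ)
    (u : {u : ℝ // 0 ≤ u ∧ θ u ≠ ⊤}) : A - B * s ≤ (θ u).toReal + n * |s - u| := by
  have := le_toReal_add_mul_abs (n := n) hθ hB hlow s u.2.1 u.2.2
  nlinarith [mul_nonneg (sub_nonneg.2 hn) (abs_nonneg (s - u))]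

lemma le_lipschitzEnvelope (hθ : ProperConvexLSCOn θ) (hB : 0 ≤ B)
    (hlow : ∀ u, 0 ≤ u → ((A - B * u : ℝ) : EReal) ≤ θ u) (hn : B ≤ n) (s : ℝ) :
    A - B * s ≤ lipschitzEnvelope θ n s :=
  have : Nonempty {u : ℝ // 0 ≤ u ∧ θ u ≠ ⊤} := nonempty_subtype.2 hθ.exists_ne_top
  le_ciInf (le_lipschitzEnvelope_aux hθ hB hlow hn s)

lemma lipschitzEnvelope_le (hθ : ProperConvexLSCOn θ) (hB : 0 ≤ B)
    (hlow : ∀ u, 0 ≤ u → ((A - B * u : ℝ) : EReal) ≤ θ u) (hn : B ≤ n) (s : ℝ) {u : ℝ}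
    (hu : 0 ≤ u) (hu' : θ u ≠ ⊤) :
    lipschitzEnvelope θ n s ≤ (θ u).toReal + n * |s - u| :=
  ciInf_le ⟨A - B * s, Set.forall_mem_range.2 (le_lipschitzEnvelope_aux hθ hB hlow hn s)⟩
    (⟨u, hu, hu'⟩ : {u : ℝ // 0 ≤ u ∧ θ u ≠ ⊤})

lemma exists_lt_lipschitzEnvelope_add (hθ : ProperConvexLSCOn θ) (n s : ℝ) {ε : ℝ} (hε : 0 < ε) :
    ∃ u, 0 ≤ u ∧ θ u ≠ ⊤ ∧ (θ u).toReal + n * |s - u| < lipschitzEnvelope θ n s + ε := by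
  have : Nonempty {u : ℝ // 0 ≤ u ∧ θ u ≠ ⊤} := nonempty_subtype.2 hθ.exists_ne_top
  obtain ⟨u, hu⟩ := exists_lt_of_ciInf_lt (lt_add_of_pos_right (lipschitzEnvelope θ n s) hε)
  exact ⟨u, u.2.1, u.2.2, hu⟩

lemma coe_lipschitzEnvelope_le (hθ : ProperConvexLSCOn θ) (hB : 0 ≤ B)
    (hlow : ∀ u, 0 ≤ u → ((A - B * u : ℝ) : EReal) ≤ θ u) (hn : B ≤ n) {s : ℝ} (hs : 0 ≤ s) :
    (lipschitzEnvelope θ n s : EReal) ≤ θ s := by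
  by_cases hs' : θ s = ⊤
  · rw [hs']; exact le_top
  rw [← hθ.coe_toReal_eq hs hs', EReal.coe_le_coe_iff]
  simpa using lipschitzEnvelope_le hθ hB hlow hn s hs hs'

lemma abs_lipschitzEnvelope_sub_le (hθ : ProperConvexLSCOn θ) (hB : 0 ≤ B)
    (hlow : ∀ u, 0 ≤ u → ((A - B * u : ℝ) : EReal) ≤ θ u) (hn : B ≤ n) (x y : ℝ) :
    |lipschitzEnvelope θ n x - lipschitzEnvelope θ n y| ≤ n * |x - y| := by
  have hn0 : 0 ≤ n := hB.trans hn
  have key : ∀ x y, lipschitzEnvelope θ n x ≤ lipschitzEnvelope θ n y + n * |x - y| := by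
    refine fun x y => le_of_forall_pos_le_add fun ε hε => ?_
    obtain ⟨u, hu, hu', hlt⟩ := exists_lt_lipschitzEnvelope_add hθ n y hε
    have h1 := lipschitzEnvelope_le hθ hB hlow hn x hu hu'
    nlinarith [mul_le_mul_of_nonneg_left (abs_sub_le x y u) hn0]
  have h1 := key x y
  have h2 := key y x
  rw [abs_sub_comm y x] at h2
  rw [abs_le]; constructor <;> linarith

lemma convexOn_lipschitzEnvelope (hθ : ProperConvexLSCOn θ) (hB : 0 ≤ B)
    (hlow : ∀ u, 0 ≤ u → ((A - B * u : ℝ) : EReal) ≤ θ u) (hn : B ≤ n) :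
    ConvexOn ℝ Set.univ (lipschitzEnvelope θ n) := by
  have hn0 : 0 ≤ n := hB.trans hn
  refine ⟨convex_univ, fun x _ y _ a b ha hb hab => le_of_forall_pos_le_add fun ε hε => ?_⟩
  obtain ⟨u, hu, hu', hul⟩ := exists_lt_lipschitzEnvelope_add hθ n x hε
  obtain ⟨w, hw, hw', hwl⟩ := exists_lt_lipschitzEnvelope_add hθ n y hε
  have hc := hθ.convex_coe hu hw hu' hw' ha hb hab
  have hz : 0 ≤ a * u + b * w := by positivity
  have hz' : θ (a * u + b * w) ≠ ⊤ := ne_top_of_le_ne_top (EReal.coe_ne_top _) hc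
  rw [← hθ.coe_toReal_eq hz hz', EReal.coe_le_coe_iff] at hc
  have h1 := lipschitzEnvelope_le hθ hB hlow hn (a * x + b * y) hz hz'
  have h2 : |a * x + b * y - (a * u + b * w)| ≤ a * |x - u| + b * |y - w| := by
    have e : a * x + b * y - (a * u + b * w) = a * (x - u) + b * (y - w) := by ring
    rw [e]
    refine (abs_add_le _ _).trans_eq ?_
    rw [abs_mul, abs_mul, abs_of_nonneg ha, abs_of_nonneg hb]
  have h3 := mul_le_mul_of_nonneg_left h2 hn0
  have h4 := mul_le_mul_of_nonneg_left hul.le ha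
  have h5 := mul_le_mul_of_nonneg_left hwl.le hb
  have h6 : a * ε + b * ε = ε := by rw [← add_mul, hab, one_mul]
  simp only [smul_eq_mul]
  linarith

lemma lipschitzEnvelope_mono (hθ : ProperConvexLSCOn θ) (hB : 0 ≤ B)
    (hlow : ∀ u, 0 ≤ u → ((A - B * u : ℝ) : EReal) ≤ θ u) (hn : B ≤ n) {m : ℝ} (hnm : n ≤ m)
    (s : ℝ) : lipschitzEnvelope θ n s ≤ lipschitzEnvelope θ m s := by
  refine le_of_forall_pos_le_add fun ε hε => ?_
  obtain ⟨u, hu, hu', hlt⟩ := exists_lt_lipschitzEnvelope_add hθ m s hε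
  have h1 := lipschitzEnvelope_le hθ hB hlow hn s hu hu'
  nlinarith [mul_le_mul_of_nonneg_right hnm (abs_nonneg (s - u))]

lemma lipschitzEnvelope_add_le (hθ : ProperConvexLSCOn θ) (hB : 0 ≤ B)
    (hlow : ∀ u, 0 ≤ u → ((A - B * u : ℝ) : EReal) ≤ θ u) (hn : B ≤ n) {d : ℝ}
    (hd : recessionSlope θ ≤ d) (s : ℝ) {v : ℝ} (hv : 0 ≤ v) :
    lipschitzEnvelope θ n (s + v) ≤ lipschitzEnvelope θ n s + d * v := by
  refine le_of_forall_pos_le_add fun ε hε => ?_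
  obtain ⟨u, hu, hu', hlt⟩ := exists_lt_lipschitzEnvelope_add hθ n s (half_pos hε)
  set η := ε / 2 / (v + 1)
  have hη : 0 < η := by positivity
  have hηv : η * v ≤ ε / 2 := by
    have : η * (v + 1) = ε / 2 := by simp only [η]; field_simp
    linarith
  have hc := hθ.add_le_of_recessionSlope_lt (e := d + η)
    (hd.trans_lt (by exact_mod_cast lt_add_of_pos_right d hη)) hu hu' hv
  have hz : 0 ≤ u + v := by positivity
  have hz' : θ (u + v) ≠ ⊤ := ne_top_of_le_ne_top (EReal.coe_ne_top _) hc
  rw [← hθ.coe_toReal_eq hz hz', EReal.coe_le_coe_iff] at hc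
  have h1 := lipschitzEnvelope_le hθ hB hlow hn (s + v) hz hz'
  rw [add_sub_add_right_eq_sub] at h1
  linarith

lemma tendsto_lipschitzEnvelope (hθ : ProperConvexLSCOn θ) (hB : 0 ≤ B)
    (hlow : ∀ u, 0 ≤ u → ((A - B * u : ℝ) : EReal) ≤ θ u) {s : ℝ} (hs : 0 ≤ s) :
    Tendsto (fun k : ℕ => (lipschitzEnvelope θ (B + k) s : EReal)) atTop (nhds (θ s)) := by
  have hn : ∀ k : ℕ, B ≤ B + k := fun k => le_add_of_nonneg_right k.cast_nonneg
  refine tendsto_order.2 ⟨fun a ha => ?_, fun b hb => .of_forall fun k =>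
    (coe_lipschitzEnvelope_le hθ hB hlow (hn k) hs).trans_lt hb⟩
  obtain ⟨c, hac, hc⟩ := EReal.lt_iff_exists_real_btwn.1 ha
  obtain ⟨δ, hδ, hball⟩ := Metric.mem_nhdsWithin_iff.1 (hθ.lsc s hs _ hc)
  filter_upwards [eventually_ge_atTop ⌈(c - A + B * s) / δ⌉₊] with k hk
  have hk' : c ≤ A - B * s + k * δ := by
    have h1 : (⌈(c - A + B * s) / δ⌉₊ : ℝ) ≤ k := by exact_mod_cast hk
    have h2 := (Nat.le_ceil _).trans h1
    rw [div_le_iff₀ hδ] at h2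
    linarith
  refine hac.trans_le (EReal.coe_le_coe_iff.2 (le_of_forall_pos_le_add fun ε hε => ?_))
  obtain ⟨u, hu, hu', hlt⟩ := exists_lt_lipschitzEnvelope_add hθ (B + k) s hε
  refine le_trans ?_ hlt.le
  rcases lt_or_ge |s - u| δ with h | h
  · have h1 : (c : EReal) < θ u :=
      hball ⟨by rwa [Metric.mem_ball, dist_comm, Real.dist_eq], hu⟩
    rw [← hθ.coe_toReal_eq hu hu', EReal.coe_lt_coe_iff] at h1
    have : 0 ≤ (B + k) * |s - u| := by positivity
    linarith
  · have h1 := le_toReal_add_mul_abs (n := B + k) hθ hB hlow s hu hu'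
    rw [add_sub_cancel_left] at h1
    have : (k : ℝ) * δ ≤ k * |s - u| := by gcongr
    linarith

end Envelope

lemma recessionSlope_ne_bot {θ : ℝ → EReal} (hθ : ProperConvexLSCOn θ) : recessionSlope θ ≠ ⊥ := by
  intro h
  obtain ⟨u, hu, hu'⟩ := hθ.exists_ne_top
  have hlt : ∀ e : ℝ, recessionSlope θ < e := fun e => h ▸ EReal.bot_lt_coe e
  have h1 := fun e => hθ.add_le_of_recessionSlope_lt (hlt e) hu hu' zero_le_one
  have hz : 0 ≤ u + 1 := by positivity
  have hz' : θ (u + 1) ≠ ⊤ := ne_top_of_le_ne_top (EReal.coe_ne_top _) (h1 0)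
  have h2 := h1 ((θ (u + 1)).toReal - (θ u).toReal - 1)
  rw [← hθ.coe_toReal_eq hz hz', EReal.coe_le_coe_iff, EReal.toReal_coe] at h2
  linarith

lemma erealIntegral_eq {Ω : Type} [MeasurableSpace Ω] (μ : Measure Ω) (f : Ω → EReal) :
    erealIntegral μ f = ((∫⁻ x, (f x).toENNReal ∂μ : ℝ≥0∞) : EReal)
      - ((∫⁻ x, (-f x).toENNReal ∂μ : ℝ≥0∞) : EReal) := rfl

lemma erealIntegral_mono {Ω : Type} [MeasurableSpace Ω] {μ : Measure Ω} {f g : Ω → EReal}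
    (h : ∀ x, f x ≤ g x) : erealIntegral μ f ≤ erealIntegral μ g := by
  rw [erealIntegral_eq, erealIntegral_eq]
  refine EReal.sub_le_sub ?_ ?_ <;> rw [EReal.coe_ennreal_le_coe_ennreal_iff] <;>
    refine lintegral_mono fun x => EReal.toENNReal_le_toENNReal ?_
  exacts [h x, EReal.neg_le_neg_iff.2 (h x)]

lemma erealIntegral_coe {Ω : Type} [MeasurableSpace Ω] {μ : Measure Ω} {f : Ω → ℝ}
    (hf : Integrable f μ) : erealIntegral μ (fun x => (f x : EReal)) = ((∫ x, f x ∂μ : ℝ) : EReal) := by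
  have hneg : ∀ x, (-(f x : EReal)).toENNReal = ENNReal.ofReal (-f x) := fun x => by
    rw [← EReal.coe_neg, EReal.real_coe_toENNReal]
  rw [erealIntegral_eq, integral_eq_lintegral_pos_part_sub_lintegral_neg_part hf, EReal.coe_sub]
  simp only [hneg, EReal.real_coe_toENNReal]
  rw [EReal.coe_ennreal_toReal, EReal.coe_ennreal_toReal]
  · exact hf.neg.lintegral_lt_top.ne
  · exact hf.lintegral_lt_top.ne

lemma tendsto_erealIntegral_of_monotone {Ω : Type} [MeasurableSpace Ω] {μ : Measure Ω}
    {f : ℕ → Ω → ℝ} {F : Ω → EReal} (hf : ∀ n, Integrable (f n) μ)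
    (hmono : ∀ x, Monotone fun n => f n x)
    (hlim : ∀ x, Tendsto (fun n => (f n x : EReal)) atTop (nhds (F x))) :
    Tendsto (fun n => erealIntegral μ (fun x => (f n x : EReal))) atTop
      (nhds (erealIntegral μ F)) := by
  have hae : ∀ n, AEMeasurable (fun x => (f n x : EReal)) μ :=
    fun n => (hf n).aemeasurable.coe_real_ereal
  have hpos : Tendsto (fun n => ∫⁻ x, ((f n x : EReal)).toENNReal ∂μ) atTop
      (nhds (∫⁻ x, (F x).toENNReal ∂μ)) :=
    lintegral_tendsto_of_tendsto_of_monotone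
      (fun n => EReal.continuous_toENNReal.measurable.comp_aemeasurable (hae n))
      (.of_forall fun x _ _ hij => EReal.toENNReal_le_toENNReal
        (EReal.coe_le_coe_iff.2 (hmono x hij)))
      (.of_forall fun x => (EReal.continuous_toENNReal.tendsto _).comp (hlim x))
  have hfin : ∫⁻ x, (-(f 0 x : EReal)).toENNReal ∂μ ≠ ⊤ := by
    have hneg : ∀ x, (-(f 0 x : EReal)).toENNReal = ENNReal.ofReal (-f 0 x) := fun x => by
      rw [← EReal.coe_neg, EReal.real_coe_toENNReal]
    simp only [hneg]
    exact (hf 0).neg.lintegral_lt_top.ne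
  have hanti : ∀ x, Antitone fun n => (-(f n x : EReal)).toENNReal := fun x _ _ hij =>
    EReal.toENNReal_le_toENNReal (EReal.neg_le_neg_iff.2 (EReal.coe_le_coe_iff.2 (hmono x hij)))
  have hneglim : ∀ x, Tendsto (fun n => (-(f n x : EReal)).toENNReal) atTop
      (nhds (-F x).toENNReal) := fun x =>
    ((EReal.continuous_toENNReal.comp continuous_neg).tendsto _).comp (hlim x)
  have hneg : Tendsto (fun n => ∫⁻ x, (-(f n x : EReal)).toENNReal ∂μ) atTop
      (nhds (∫⁻ x, (-F x).toENNReal ∂μ)) :=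
    lintegral_tendsto_of_tendsto_of_antitone
      (fun n => (EReal.continuous_toENNReal.comp continuous_neg).measurable.comp_aemeasurable
        (hae n)) (.of_forall hanti) hfin (.of_forall hneglim)
  have hfinF : ∫⁻ x, (-F x).toENNReal ∂μ ≠ ⊤ := ne_top_of_le_ne_top hfin
    (lintegral_mono fun x => (hanti x).le_of_tendsto (hneglim x) 0)
  simp only [erealIntegral_eq, sub_eq_add_neg]
  refine (EReal.continuousAt_add (Or.inr ?_) (Or.inl (EReal.coe_ennreal_ne_bot _))).tendsto.comp
    (((continuous_coe_ennreal_ereal.tendsto _).comp hpos).prodMk_nhds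
      ((continuous_neg.tendsto _).comp ((continuous_coe_ennreal_ereal.tendsto _).comp hneg)))
  simpa [EReal.neg_eq_bot_iff] using hfinF

lemma erealIntegral_theta_le {Ω : Type} [MeasurableSpace Ω] {ν : Measure Ω}
    [IsFiniteMeasure ν] {p q : Ω → ℝ} (hp0 : ∀ x, 0 ≤ p x) (hq0 : ∀ x, 0 ≤ q x)
    (hp : Integrable p ν) (hq : Integrable q ν)
    (hmin : ∀ t : ℝ, 0 < t → ∫ x, min (p x) t ∂ν ≤ ∫ x, min (q x) t ∂ν)
    {θ : ℝ → EReal} (hθ : ProperConvexLSCOn θ) {C : ℝ}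
    (hC : ∀ n : ℝ, ∃ d : ℝ, (recessionSlope θ ≤ d ∨ n ≤ d) ∧
      d * (∫ x, q x ∂ν - ∫ x, p x ∂ν) ≤ C) :
    erealIntegral ν (fun x => θ (q x)) ≤ erealIntegral ν (fun x => θ (p x)) + C := by
  obtain ⟨A, B, hB, hlow⟩ := hθ.exists_affine_le
  have hn : ∀ k : ℕ, B ≤ B + k := fun k => le_add_of_nonneg_right k.cast_nonneg
  have hlip := fun k : ℕ => abs_lipschitzEnvelope_sub_le hθ hB hlow (hn k)
  have hint : ∀ k : ℕ, ∀ r : Ω → ℝ, Integrable r ν →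
      Integrable (fun x => lipschitzEnvelope θ (B + k) (r x)) ν := by
    intro k r hr
    have hL : LipschitzWith (B + k).toNNReal (lipschitzEnvelope θ (B + k)) :=
      LipschitzWith.of_dist_le_mul fun x y => by
        rw [Real.coe_toNNReal _ (hB.trans (hn k))]; exact hlip k x y
    refine ((hr.norm.const_mul (B + k)).add (integrable_const |lipschitzEnvelope θ (B + k) 0|)).mono'
      (hL.continuous.comp_aestronglyMeasurable hr.1) (.of_forall fun x => ?_)
    have h1 := hlip k (r x) 0
    have h2 := abs_sub_abs_le_abs_sub (lipschitzEnvelope θ (B + k) (r x))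
      (lipschitzEnvelope θ (B + k) 0)
    simp only [Pi.add_apply, Real.norm_eq_abs]
    rw [sub_zero] at h1
    linarith
  refine le_of_tendsto' (tendsto_erealIntegral_of_monotone (fun k => hint k q hq)
    (fun x i j hij => lipschitzEnvelope_mono hθ hB hlow (hn i) (by gcongr) _)
    (fun x => tendsto_lipschitzEnvelope hθ hB hlow (hq0 x))) fun k => ?_
  obtain ⟨d, hd, hdC⟩ := hC (B + k)
  have hd : ∀ s v, 0 ≤ s → 0 ≤ v → lipschitzEnvelope θ (B + k) (s + v) ≤
      lipschitzEnvelope θ (B + k) s + d * v := by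
    intro s v _ hv
    rcases hd with hd | hd
    · exact lipschitzEnvelope_add_le hθ hB hlow (hn k) hd s hv
    · have h1 := (le_abs_self _).trans (hlip k (s + v) s)
      rw [add_sub_cancel_left, abs_of_nonneg hv] at h1
      linarith [mul_le_mul_of_nonneg_right hd hv]
  have hmain := integral_comp_le_of_integral_min_le hp0 hq0 hp hq hmin
    (convexOn_lipschitzEnvelope hθ hB hlow (hn k)) (hlip k) hd
  have hpk : erealIntegral ν (fun x => (lipschitzEnvelope θ (B + k) (p x) : EReal)) ≤
      erealIntegral ν (fun x => θ (p x)) :=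
    erealIntegral_mono fun x => coe_lipschitzEnvelope_le hθ hB hlow (hn k) (hp0 x)
  refine le_trans ?_ (add_le_add_left hpk _)
  rw [erealIntegral_coe (hint k q hq), erealIntegral_coe (hint k p hp), ← EReal.coe_add,
    EReal.coe_le_coe_iff]
  linarith

lemma thetaDiv_le_of_lintegral_min_le {Ω : Type} [MeasurableSpace Ω] {P Q ν : Measure Ω}
    [IsFiniteMeasure P] [IsFiniteMeasure Q] [IsFiniteMeasure ν] {θ : ℝ → EReal}
    (hθ : ProperConvexLSCOn θ) (hmass : P Set.univ = Q Set.univ)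
    (hmin : ∀ t : ℝ, 0 < t → ∫⁻ x, min (P.rnDeriv ν x) (ENNReal.ofReal t) ∂ν ≤
      ∫⁻ x, min (Q.rnDeriv ν x) (ENNReal.ofReal t) ∂ν) :
    thetaDiv θ Q ν ≤ thetaDiv θ P ν := by
  set p : Ω → ℝ := fun x => (P.rnDeriv ν x).toReal
  set q : Ω → ℝ := fun x => (Q.rnDeriv ν x).toReal
  have hp0 : ∀ x, 0 ≤ p x := fun _ => ENNReal.toReal_nonneg
  have hq0 : ∀ x, 0 ≤ q x := fun _ => ENNReal.toReal_nonneg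
  have hp : Integrable p ν := Measure.integrable_toReal_rnDeriv
  have hq : Integrable q ν := Measure.integrable_toReal_rnDeriv
  have htoReal : ∀ (R : Measure Ω) [IsFiniteMeasure R] (t : ℝ), 0 < t →
      ∫ x, min (R.rnDeriv ν x).toReal t ∂ν =
        (∫⁻ x, min (R.rnDeriv ν x) (ENNReal.ofReal t) ∂ν).toReal := by
    intro R _ t ht
    rw [← integral_toReal ((R.measurable_rnDeriv ν).min measurable_const).aemeasurable
      (.of_forall fun x => (min_le_right _ _).trans_lt ENNReal.ofReal_lt_top)]
    refine integral_congr_ae ?_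
    filter_upwards [R.rnDeriv_lt_top ν] with x hx
    rw [ENNReal.toReal_min hx.ne ENNReal.ofReal_ne_top, ENNReal.toReal_ofReal ht.le]
  have hfin : ∀ (R : Measure Ω) (t : ℝ),
      ∫⁻ x, min (R.rnDeriv ν x) (ENNReal.ofReal t) ∂ν ≠ ⊤ := fun R t =>
    ne_top_of_le_ne_top (by simp [ENNReal.mul_eq_top]) (lintegral_mono fun x => min_le_right _ _)
  have hmin' : ∀ t : ℝ, 0 < t → ∫ x, min (p x) t ∂ν ≤ ∫ x, min (q x) t ∂ν := by
    intro t ht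
    rw [htoReal P t ht, htoReal Q t ht]
    exact ENNReal.toReal_mono (hfin Q t) (hmin t ht)
  set m : ℝ := (P.singularPart ν Set.univ).toReal
  set m' : ℝ := (Q.singularPart ν Set.univ).toReal
  have hsplit : ∀ (R : Measure Ω) [IsFiniteMeasure R], (R Set.univ).toReal =
      (R.singularPart ν Set.univ).toReal + ∫ x, (R.rnDeriv ν x).toReal ∂ν := by
    intro R _
    rw [integral_toReal (R.measurable_rnDeriv ν).aemeasurable (R.rnDeriv_lt_top ν),
      ← ENNReal.toReal_add (measure_ne_top _ _) (R.lintegral_rnDeriv_lt_top ν).ne,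
      ← setLIntegral_univ, ← withDensity_apply _ MeasurableSet.univ, ← Measure.add_apply,
      ← Measure.haveLebesgueDecomposition_add]
  have hΔ : ∫ x, q x ∂ν - ∫ x, p x ∂ν = m - m' := by
    have h1 := hsplit P
    have h2 := hsplit Q
    rw [hmass] at h1
    linarith
  have hpq : 0 ≤ ∫ x, q x ∂ν - ∫ x, p x ∂ν := by
    have hneg : ∀ x y : ℝ, |-x - -y| ≤ 1 * |x - y| := fun x y => by
      rw [one_mul, neg_sub_neg, abs_sub_comm]
    have h := integral_comp_le_of_integral_min_le hp0 hq0 hp hq hmin' (f := fun x => -x) (d := 0)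
      (concaveOn_id convex_univ).neg hneg (fun s v _ hv => by linarith)
    rw [integral_neg, integral_neg] at h
    linarith
  have hm0 : 0 ≤ m := ENNReal.toReal_nonneg
  have hm0' : 0 ≤ m' := ENNReal.toReal_nonneg
  have hm : ((P.singularPart ν Set.univ : ℝ≥0∞) : EReal) = (m : EReal) :=
    (EReal.coe_ennreal_toReal (measure_ne_top _ _)).symm
  have hm' : ((Q.singularPart ν Set.univ : ℝ≥0∞) : EReal) = (m' : EReal) :=
    (EReal.coe_ennreal_toReal (measure_ne_top _ _)).symm
  unfold thetaDiv
  rw [hm, hm']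
  rw [hΔ] at hpq
  cases hslope : recessionSlope θ with
  | bot => exact absurd hslope (recessionSlope_ne_bot hθ)
  | coe d =>
    have h := erealIntegral_theta_le hp0 hq0 hp hq hmin' hθ (C := d * (m - m'))
      fun n => ⟨d, Or.inl hslope.le, by rw [hΔ]⟩
    refine (add_le_add_left h _).trans_eq ?_
    rw [add_assoc, ← EReal.coe_mul, ← EReal.coe_mul, ← EReal.coe_add,
      mul_sub, sub_add_cancel]
  | top =>
    rcases hm0.eq_or_lt with hm0 | hm0
    · have hm'0 : m' = 0 := by linarith
      have h := erealIntegral_theta_le hp0 hq0 hp hq hmin' hθ (C := 0)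
        fun n => ⟨n, Or.inr le_rfl, by rw [hΔ, ← hm0, hm'0]; simp⟩
      simpa [← hm0, hm'0] using h
    · obtain ⟨A, B, -, hlow⟩ := hθ.exists_affine_le
      have h1 : erealIntegral ν (fun x => θ (p x)) ≠ ⊥ := by
        have h2 := erealIntegral_mono (μ := ν) fun x => hlow (p x) (hp0 x)
        have hint : Integrable (fun x => A - B * p x) ν :=
          (integrable_const A).sub (hp.const_mul B)
        rw [erealIntegral_coe hint] at h2
        exact ne_bot_of_le_ne_bot (EReal.coe_ne_bot _) h2
      rw [EReal.top_mul_coe_of_pos hm0, EReal.add_top_of_ne_bot h1]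
      exact le_top

lemma lintegral_min_rnDeriv_le_fit {E : Set (X × Y)} {νX : Measure X} {νY : Measure Y}
    [SigmaFinite νY] {π : Measure (X × Y)} (hπ : π ∈ Plans E νX) (t : ℝ) :
    ∫⁻ y, min ((π.map Prod.snd).rnDeriv νY y) (ENNReal.ofReal t) ∂νY ≤ Fit E νX νY t := by
  obtain ⟨hfin, hE, hfst⟩ := hπ
  set P := π.map Prod.snd
  set Q := νY.withDensity fun y => min (P.rnDeriv νY y) (ENNReal.ofReal t)
  have hQP : Q ≤ P := (withDensity_mono (.of_forall fun y => min_le_left _ _)).trans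
    (P.withDensity_rnDeriv_le νY)
  have hQt : Q ≤ ENNReal.ofReal t • νY := by
    rw [← withDensity_const]
    exact withDensity_mono (.of_forall fun y => min_le_right _ _)
  have : IsFiniteMeasure Q := isFiniteMeasure_of_le P hQP
  set w := Q.rnDeriv P
  have hw : Measurable w := Q.measurable_rnDeriv P
  set σ := π.withDensity (w ∘ Prod.snd)
  have hσπ : σ ≤ π := by
    have h1 : ∀ᵐ y ∂P, w y ≤ 1 := Measure.rnDeriv_le_one_of_le hQP
    have h2 := ae_of_ae_map measurable_snd.aemeasurable h1
    refine (withDensity_mono (g := 1) h2).trans_eq ?_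
    exact withDensity_one
  have hσQ : σ.map Prod.snd = Q := by
    rw [← Measure.withDensity_rnDeriv_eq Q P (Measure.absolutelyContinuous_of_le hQP)]
    ext s hs
    rw [Measure.map_apply measurable_snd hs, withDensity_apply _ (measurable_snd hs),
      withDensity_apply _ hs, setLIntegral_map hs hw measurable_snd]
    rfl
  have hmass : ∫⁻ y, min (P.rnDeriv νY y) (ENNReal.ofReal t) ∂νY = σ Set.univ := by
    rw [← setLIntegral_univ, ← withDensity_apply _ MeasurableSet.univ]
    change Q Set.univ = _
    rw [← hσQ, Measure.map_apply measurable_snd MeasurableSet.univ, Set.preimage_univ]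
  rw [hmass]
  refine le_iSup₂_of_le σ ⟨isFiniteMeasure_of_le π hσπ, ?_, ?_, hσQ.trans_le hQt⟩ le_rfl
  · exact le_antisymm ((hσπ _).trans hE.le) zero_le
  · exact (Measure.map_mono hσπ measurable_fst).trans hfst.le

theorem level_opt_maximin_implies_theta_opt
    [TopologicalSpace X] [PolishSpace X] [BorelSpace X]
    [TopologicalSpace Y] [PolishSpace Y] [BorelSpace Y]
    (E : Set (X × Y)) (hE : IsClosed E)
    (νX : Measure X) (νY : Measure Y) [IsFiniteMeasure νX] [IsFiniteMeasure νY]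
    (hνX : 0 < νX Set.univ) (hνY : 0 < νY Set.univ)
    (hNbhdX : ∀ x : X, ∃ y : Y, (x, y) ∈ E) (hNbhdY : ∀ y : Y, ∃ x : X, (x, y) ∈ E)
    (θ : ℝ → EReal) (hθ : ProperConvexLSCOn θ)
    (πs : Measure (X × Y)) (hπs : πs ∈ Plans E νX)
    (hlom : LevelOptMaximin E νX νY πs) :
    thetaDiv θ (πs.map Prod.snd) νY
      = sInf {d : EReal | ∃ π ∈ Plans E νX, d = thetaDiv θ (π.map Prod.snd) νY} := by
  refine le_antisymm (le_sInf ?_) (sInf_le ⟨πs, hπs, rfl⟩)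
  rintro _ ⟨π, hπ, rfl⟩
  have := hπ.1
  have := hπs.1
  refine thetaDiv_le_of_lintegral_min_le hθ ?_ fun t ht =>
    (lintegral_min_rnDeriv_le_fit hπ t).trans_eq (hlom t ht).symm
  have hmass : ∀ ρ ∈ Plans E νX, ρ.map Prod.snd Set.univ = νX Set.univ := fun ρ hρ => by
    rw [← hρ.2.2, Measure.map_apply measurable_snd MeasurableSet.univ,
      Measure.map_apply measurable_fst MeasurableSet.univ, Set.preimage_univ, Set.preimage_univ]
  rw [hmass π hπ, hmass πs hπs]
end
end
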